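/- arXiv:2202.06714 — 5 statements merged into one kernel-verified Lean document; each statement's English description precedes it below -/
import Mathlib

section
/- Let μ be a probability measure on the unit circle with Cauchy transform f_μ. Then for every θ ∈ ℝ the function r ↦ (r − 1)·|Re f_μ(r·e^{iθ})| is monotone nondecreasing on (1, ∞): for all 1 < r₁ ≤ r₂ one has (r₁ − 1)·|Re f_μ(r₁·e^{iθ})| ≤ (r₂ − 1)·|Re f_μ(r₂·e^{iθ})|. -/
open MeasureTheory

noncomputable section

instance : MeasurableSpace Circle := borel Circle
instance : BorelSpace Circle := ⟨rfl⟩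

/-- The Cauchy transform of a measure `μ` on the unit circle:
`f_μ(z) = ∫ (u + z)/(u − z) dμ(u)`. -/
def cauchyTransform (μ : Measure Circle) (z : ℂ) : ℂ :=
  ∫ u : Circle, ((u : ℂ) + z) / ((u : ℂ) - z) ∂μ

theorem re_add_div_sub_of_norm_eq_one {u : ℂ} (hu : ‖u‖ = 1) (z : ℂ) :
    ((u + z) / (u - z)).re = (1 - Complex.normSq z) / Complex.normSq (u - z) := by
  have hu' : u.re * u.re + u.im * u.im = 1 := by
    rw [← Complex.normSq_apply, Complex.normSq_eq_norm_sq, hu, one_pow]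
  rw [Complex.div_re, ← add_div, ← hu', Complex.normSq_apply z]
  congr 1
  simp only [Complex.add_re, Complex.add_im, Complex.sub_re, Complex.sub_im]
  ring

theorem circle_sub_ne_zero {z : ℂ} (hz : 1 < ‖z‖) (u : Circle) : (u : ℂ) - z ≠ 0 := by
  intro h
  rw [← sub_eq_zero.mp h, Circle.norm_coe] at hz
  exact lt_irrefl _ hz

theorem integrable_cauchyKernel (μ : Measure Circle) [IsFiniteMeasure μ] {z : ℂ} (hz : 1 < ‖z‖) :
    Integrable (fun u : Circle ↦ ((u : ℂ) + z) / ((u : ℂ) - z)) μ := by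
  have hc : Continuous fun u : Circle ↦ ((u : ℂ) + z) / ((u : ℂ) - z) :=
    (by fun_prop : Continuous fun u : Circle ↦ (u : ℂ) + z).div₀ (by fun_prop)
      (circle_sub_ne_zero hz)
  exact hc.integrable_of_hasCompactSupport (HasCompactSupport.of_compactSpace _)

/-- Outside the closed unit disc, `|Re f_μ|` is the integral of the exterior Poisson kernel. -/
theorem abs_re_cauchyTransform (μ : Measure Circle) [IsFiniteMeasure μ] {z : ℂ} (hz : 1 < ‖z‖) :
    Integrable (fun u : Circle ↦ (Complex.normSq z - 1) / Complex.normSq (u - z)) μ ∧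
      |(cauchyTransform μ z).re| =
        ∫ u : Circle, (Complex.normSq z - 1) / Complex.normSq (u - z) ∂μ := by
  have hker (u : Circle) : (Complex.normSq z - 1) / Complex.normSq (u - z) =
      -(((u : ℂ) + z) / ((u : ℂ) - z)).re := by
    rw [re_add_div_sub_of_norm_eq_one (Circle.norm_coe u), ← neg_div, neg_sub]
  have hint := integrable_cauchyKernel μ hz
  have hnonneg (u : Circle) : 0 ≤ (Complex.normSq z - 1) / Complex.normSq (u - z) := by
    refine div_nonneg ?_ (Complex.normSq_nonneg _)
    rw [Complex.normSq_eq_norm_sq]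
    nlinarith
  have hre : (cauchyTransform μ z).re =
      -∫ u : Circle, (Complex.normSq z - 1) / Complex.normSq (u - z) ∂μ := by
    simp_rw [hker, integral_neg, neg_neg]
    exact (Complex.reCLM.integral_comp_comm hint).symm
  refine ⟨?_, by rw [hre, abs_neg, abs_of_nonneg (integral_nonneg hnonneg)]⟩
  simp_rw [hker]
  exact (Complex.reCLM.integrable_comp hint).neg

/-- With `t = 1 - cos φ`, this is the radial monotonicity of `(r - 1)` times the exterior
Poisson kernel at angle `φ`. -/
theorem weighted_poisson_le {a b t : ℝ} (ha : 1 < a) (hab : a ≤ b) (ht : 0 ≤ t) :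
    (a - 1) * ((a ^ 2 - 1) / ((a - 1) ^ 2 + 2 * a * t)) ≤
      (b - 1) * ((b ^ 2 - 1) / ((b - 1) ^ 2 + 2 * b * t)) := by
  have hA : 0 < (a - 1) ^ 2 + 2 * a * t :=
    add_pos_of_pos_of_nonneg (pow_pos (by linarith) 2) (mul_nonneg (by linarith) ht)
  have hB : 0 < (b - 1) ^ 2 + 2 * b * t :=
    add_pos_of_pos_of_nonneg (pow_pos (by linarith) 2) (mul_nonneg (by linarith) ht)
  have h₁ : (a - 1) ^ 2 * b ≤ (b - 1) ^ 2 * a := by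
    have : 0 ≤ (b - a) * (a * b - 1) := mul_nonneg (by linarith) (by nlinarith)
    linarith
  have h₂ : (a - 1) ^ 2 * b * (a + 1) ≤ (b - 1) ^ 2 * a * (b + 1) :=
    mul_le_mul h₁ (by linarith) (by linarith) (mul_nonneg (sq_nonneg _) (by linarith))
  have h₃ : 0 ≤ (a - 1) ^ 2 * (b - 1) ^ 2 * (b - a) := mul_nonneg (by positivity) (by linarith)
  rw [mul_div_assoc', mul_div_assoc', div_le_div_iff₀ hA hB]
  linarith [mul_le_mul_of_nonneg_left h₂ ht]

theorem normSq_circle_sub_mul (u w : Circle) (r : ℝ) :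
    Complex.normSq (u - r * w) =
      (r - 1) ^ 2 + 2 * r * (1 - ((u : ℂ) * (starRingEnd ℂ) w).re) := by
  rw [Complex.normSq_sub, Complex.normSq_mul, Circle.normSq_coe, Circle.normSq_coe,
    Complex.normSq_ofReal, map_mul, Complex.conj_ofReal, mul_left_comm, Complex.re_ofReal_mul]
  ring

/-- For a probability measure `μ` on the unit circle and any `θ ∈ ℝ`,
the function `r ↦ (r − 1)·|Re f_μ(r·e^{iθ})|` is monotone nondecreasing on `(1, ∞)`. -/
theorem stmt_1 (μ : Measure Circle) [IsProbabilityMeasure μ] (θ : ℝ) (r₁ r₂ : ℝ)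
    (hr₁ : 1 < r₁) (hr₁₂ : r₁ ≤ r₂) :
    (r₁ - 1) * |(cauchyTransform μ ((r₁ : ℂ) * Complex.exp ((θ : ℂ) * Complex.I))).re| ≤
      (r₂ - 1) * |(cauchyTransform μ ((r₂ : ℂ) * Complex.exp ((θ : ℂ) * Complex.I))).re| := by
  have hnorm {r : ℝ} (hr : 1 < r) : ‖(r : ℂ) * Circle.exp θ‖ = r := by
    rw [norm_mul, Circle.norm_coe, mul_one, Complex.norm_of_nonneg (by linarith)]
  have hr₂ : 1 < r₂ := hr₁.trans_le hr₁₂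
  rw [← Circle.coe_exp]
  obtain ⟨hi₁, he₁⟩ := abs_re_cauchyTransform μ (hr₁.trans_eq (hnorm hr₁).symm)
  obtain ⟨hi₂, he₂⟩ := abs_re_cauchyTransform μ (hr₂.trans_eq (hnorm hr₂).symm)
  rw [he₁, he₂, ← integral_const_mul, ← integral_const_mul]
  refine integral_mono (hi₁.const_mul _) (hi₂.const_mul _) fun u ↦ ?_
  have ht : 0 ≤ 1 - ((u : ℂ) * (starRingEnd ℂ) (Circle.exp θ)).re := by
    have := Complex.re_le_norm ((u : ℂ) * (starRingEnd ℂ) (Circle.exp θ))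
    rw [norm_mul, RCLike.norm_conj, Circle.norm_coe, Circle.norm_coe] at this
    linarith
  simp only [normSq_circle_sub_mul, Complex.normSq_eq_norm_sq ((_ : ℂ) * _), hnorm hr₁, hnorm hr₂]
  exact weighted_poisson_le hr₁ hr₁₂ ht

end
end

section
/- Let 0 < E < π and M > 0, and let ρ be a probability density on [−π,π] with ρ(x) = ρ(−x) for all x, supported in [−E,E], and assume that either ρ ≤ M almost everywhere or E < π/8. Let f denote the Cauchy transform of ρ. Then: (i) for every ε > 0 there exists c_ε > 0, depending only on E, M and ε, such that for all r with 0 < r − 1 < c_ε and all θ with E < θ < π − ε one has Im f(r·e^{iθ}) < Im f(e^{iθ}); and (ii) for all θ, φ with E < θ ≤ φ ≤ π one has 0 ≤ Im f(e^{iφ}) ≤ Im f(e^{iθ}). -/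
open MeasureTheory

noncomputable section

/-- The Cauchy transform of an integrable density `ρ` on `[−π, π]`:
`f_ρ(z) = ∫_{−π}^{π} (e^{iθ} + z)/(e^{iθ} − z)·ρ(θ) dθ`. -/
def cauchyTransformD (ρ : ℝ → ℝ) (z : ℂ) : ℂ :=
  ∫ θ in (-Real.pi)..Real.pi,
    ((Complex.exp ((θ : ℂ) * Complex.I) + z) / (Complex.exp ((θ : ℂ) * Complex.I) - z)) *
      (ρ θ : ℂ)

/-- `ρ` is a symmetric probability density on `[−π, π]` supported in `[−E, E]`. -/
def IsSymDensity (E : ℝ) (ρ : ℝ → ℝ) : Prop :=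
  (∀ x, 0 ≤ ρ x) ∧ (∫ x in (-Real.pi)..Real.pi, ρ x) = 1 ∧ (∀ x, ρ x = ρ (-x)) ∧
    (∀ x, E < |x| → ρ x = 0)

/-- The imaginary part of `(1 + w) / (1 - w)` for `w = r * exp (i t)`, as a function of
`c = cot (t / 2)`. -/
def imKernel (r c : ℝ) : ℝ :=
  4 * r * c / ((r - 1) ^ 2 * c ^ 2 + (r + 1) ^ 2)

lemma imKernel_den_pos {r : ℝ} (hr : 1 ≤ r) (c : ℝ) :
    0 < (r - 1) ^ 2 * c ^ 2 + (r + 1) ^ 2 := by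
  have : 0 < (r + 1) ^ 2 := by positivity
  nlinarith [mul_nonneg (sq_nonneg (r - 1)) (sq_nonneg c)]

lemma imKernel_one (c : ℝ) : imKernel 1 c = c := by
  unfold imKernel; ring

lemma imKernel_add_lt {r a b : ℝ} (hr : 1 < r) (hab : 0 < a + b) :
    imKernel r a + imKernel r b < a + b := by
  have ha := imKernel_den_pos hr.le a
  have hb := imKernel_den_pos hr.le b
  unfold imKernel
  rw [div_add_div _ _ ha.ne' hb.ne', div_lt_iff₀ (mul_pos ha hb), ← sub_pos]
  have hd : 0 < (r - 1) ^ 2 := by have := sub_pos.2 hr; positivity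
  have key : 0 < (a + b) * ((r - 1) ^ 2 * ((r + 1) ^ 2 * (1 + (a ^ 2 - a * b + b ^ 2)) +
      (r - 1) ^ 2 * (a * b + a ^ 2 * b ^ 2))) := by
    refine mul_pos hab (mul_pos hd ?_)
    have h1 : 0 ≤ a ^ 2 - a * b + b ^ 2 := by nlinarith [sq_nonneg (a - b), sq_nonneg (a + b)]
    have h2 : (r - 1) ^ 2 ≤ (r + 1) ^ 2 := by nlinarith
    have h3 : 0 < 1 + (a ^ 2 - a * b + b ^ 2) + (a * b + a ^ 2 * b ^ 2) := by
      nlinarith [sq_nonneg (a * b), sq_nonneg a, sq_nonneg b]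
    nlinarith [mul_pos hd h3, mul_nonneg (sub_nonneg.2 h2)
      (add_nonneg zero_le_one h1)]
  refine key.trans_le (le_of_eq ?_)
  ring

lemma sin_half_pos {t : ℝ} (h0 : 0 < t) (h1 : t < 2 * Real.pi) : 0 < Real.sin (t / 2) :=
  Real.sin_pos_of_pos_of_lt_pi (by linarith) (by linarith)

lemma cot_half_add {a b : ℝ} (ha : Real.sin (a / 2) ≠ 0) (hb : Real.sin (b / 2) ≠ 0) :
    Real.cot (a / 2) + Real.cot (b / 2) =
      Real.sin ((a + b) / 2) / (Real.sin (a / 2) * Real.sin (b / 2)) := by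
  rw [Real.cot_eq_cos_div_sin, Real.cot_eq_cos_div_sin, add_div a b 2, Real.sin_add]
  field_simp
  ring

lemma cot_half_add_pos {a b : ℝ} (ha : 0 < a) (hb : 0 < b) (hab : a + b < 2 * Real.pi) :
    0 < Real.cot (a / 2) + Real.cot (b / 2) := by
  have h1 := sin_half_pos ha (by linarith)
  have h2 := sin_half_pos hb (by linarith)
  rw [cot_half_add h1.ne' h2.ne']
  exact div_pos (sin_half_pos (by linarith) hab) (mul_pos h1 h2)

lemma cot_half_anti {a b : ℝ} (ha : 0 < a) (hab : a ≤ b) (hb : b < 2 * Real.pi) :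
    Real.cot (b / 2) ≤ Real.cot (a / 2) := by
  have h1 := sin_half_pos ha (by linarith)
  have h2 := sin_half_pos (ha.trans_le hab) hb
  rw [Real.cot_eq_cos_div_sin, Real.cot_eq_cos_div_sin, div_le_div_iff₀ h2 h1]
  have h3 : 0 ≤ Real.sin (b / 2 - a / 2) :=
    Real.sin_nonneg_of_nonneg_of_le_pi (by linarith) (by linarith)
  rw [Real.sin_sub] at h3
  linarith

lemma cos_eq_sin_half (t : ℝ) : Real.cos t = 1 - 2 * Real.sin (t / 2) ^ 2 := by
  have h := Real.cos_two_mul (t / 2)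
  rw [mul_div_cancel₀ t two_ne_zero] at h
  nlinarith [Real.sin_sq_add_cos_sq (t / 2)]

lemma normSq_exp_sub (r θ x : ℝ) :
    Complex.normSq (Complex.exp ((x : ℂ) * Complex.I) -
      (r : ℂ) * Complex.exp ((θ : ℂ) * Complex.I)) =
      (r - 1) ^ 2 + 4 * r * Real.sin ((θ - x) / 2) ^ 2 := by
  have h := cos_eq_sin_half (θ - x)
  rw [Real.cos_sub] at h
  simp only [Complex.normSq_apply, Complex.sub_re, Complex.sub_im, Complex.re_ofReal_mul,
    Complex.im_ofReal_mul, Complex.exp_ofReal_mul_I_re, Complex.exp_ofReal_mul_I_im]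
  linear_combination (-2 * r) * h + Real.sin_sq_add_cos_sq x +
    r ^ 2 * Real.sin_sq_add_cos_sq θ

lemma normSq_exp_sub_pos {r θ x : ℝ} (hr : 1 ≤ r) (hs : Real.sin ((θ - x) / 2) ≠ 0) :
    0 < Complex.normSq (Complex.exp ((x : ℂ) * Complex.I) -
      (r : ℂ) * Complex.exp ((θ : ℂ) * Complex.I)) := by
  rw [normSq_exp_sub]
  positivity

lemma im_kernel_eq {r θ x : ℝ} (hr : 1 ≤ r) (hs : Real.sin ((θ - x) / 2) ≠ 0) :
    ((Complex.exp ((x : ℂ) * Complex.I) + (r : ℂ) * Complex.exp ((θ : ℂ) * Complex.I)) /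
      (Complex.exp ((x : ℂ) * Complex.I) - (r : ℂ) * Complex.exp ((θ : ℂ) * Complex.I))).im =
      imKernel r (Real.cot ((θ - x) / 2)) := by
  have hN := normSq_exp_sub_pos hr hs
  rw [Complex.div_im, ← sub_div]
  have hd := imKernel_den_pos hr (Real.cot ((θ - x) / 2))
  have hsin : Real.sin (θ - x) = 2 * Real.sin ((θ - x) / 2) * Real.cos ((θ - x) / 2) := by
    rw [← Real.sin_two_mul, mul_div_cancel₀ _ two_ne_zero]
  unfold imKernel
  rw [div_eq_div_iff hN.ne' hd.ne', normSq_exp_sub, Real.cot_eq_cos_div_sin]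
  simp only [Complex.sub_re, Complex.sub_im, Complex.add_re, Complex.add_im,
    Complex.re_ofReal_mul,
    Complex.im_ofReal_mul, Complex.exp_ofReal_mul_I_re, Complex.exp_ofReal_mul_I_im]
  have hnum : (Real.sin x + r * Real.sin θ) * (Real.cos x - r * Real.cos θ) -
      (Real.cos x + r * Real.cos θ) * (Real.sin x - r * Real.sin θ) =
      4 * r * (Real.sin ((θ - x) / 2) * Real.cos ((θ - x) / 2)) := by
    rw [Real.sin_sub] at hsin
    linear_combination 2 * r * hsin
  rw [hnum]
  have hc : Real.cos ((θ - x) / 2) ^ 2 = 1 - Real.sin ((θ - x) / 2) ^ 2 := by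
    linarith [Real.sin_sq_add_cos_sq ((θ - x) / 2)]
  field_simp
  rw [hc]
  ring

namespace IsSymDensity

variable {E : ℝ} {ρ : ℝ → ℝ}

lemma intervalIntegrable (h : IsSymDensity E ρ) (hE : 0 < E) (hEpi : E < Real.pi) :
    IntervalIntegrable ρ volume (-E) E := by
  have h1 : IntervalIntegrable ρ volume (-Real.pi) Real.pi := by
    by_contra hn
    have := h.2.1
    rw [intervalIntegral.integral_undef hn] at this
    exact zero_ne_one this
  refine h1.mono_set ?_
  rw [Set.uIcc_of_le (by linarith), Set.uIcc_of_le (by linarith)]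
  exact Set.Icc_subset_Icc (by linarith) hEpi.le

lemma integral_mul_eq {𝕜 : Type*} [RCLike 𝕜] (h : IsSymDensity E ρ) (hE : 0 < E)
    (hEpi : E < Real.pi) (g : ℝ → 𝕜) :
    ∫ x in (-Real.pi)..Real.pi, g x * (ρ x : 𝕜) = ∫ x in (-E)..E, g x * (ρ x : 𝕜) := by
  rw [intervalIntegral.integral_of_le (by linarith), intervalIntegral.integral_of_le (by linarith),
    ← integral_Icc_eq_integral_Ioc, ← integral_Icc_eq_integral_Ioc]
  refine (setIntegral_eq_of_subset_of_forall_sdiff_eq_zero measurableSet_Icc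
    (Set.Icc_subset_Icc (by linarith) hEpi.le) fun x hx => ?_)
  have : E < |x| := by
    by_contra hn
    exact hx.2 (abs_le.1 (not_lt.1 hn))
  simp [h.2.2.2 x this]

lemma integral_eq_one (h : IsSymDensity E ρ) (hE : 0 < E) (hEpi : E < Real.pi) :
    ∫ x in (-E)..E, ρ x = 1 := by
  have := h.integral_mul_eq hE hEpi (fun _ => (1 : ℝ))
  simp only [one_mul] at this
  exact this.symm.trans h.2.1

lemma integral_mul_comp_neg (h : IsSymDensity E ρ) (g : ℝ → ℝ) :
    ∫ x in (-E)..E, g (-x) * ρ x = ∫ x in (-E)..E, g x * ρ x := by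
  have := intervalIntegral.integral_comp_neg (a := -E) (b := E) (fun x => g x * ρ x)
  simp only [← h.2.2.1, neg_neg] at this
  exact this

/-- A continuous kernel whose even part is positive on `[-E, E]` has a positive integral against
a symmetric density. -/
lemma integral_mul_pos (h : IsSymDensity E ρ) (hE : 0 < E) (hEpi : E < Real.pi) {g : ℝ → ℝ}
    (hg : ContinuousOn g (Set.Icc (-E) E)) (hpos : ∀ x ∈ Set.Icc (-E) E, 0 < g x + g (-x)) :
    0 < ∫ x in (-E)..E, g x * ρ x := by
  have hle : -E ≤ E := by linarith
  have hρ := h.intervalIntegrable hE hEpi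
  have hg' : ContinuousOn (fun x => g (-x)) (Set.Icc (-E) E) :=
    hg.comp continuousOn_neg fun x hx => ⟨by linarith [hx.2], by linarith [hx.1]⟩
  rw [← Set.uIcc_of_le hle] at hg hg'
  have i1 := hρ.continuousOn_mul hg
  have i2 := hρ.continuousOn_mul hg'
  have hsum : ∫ x in (-E)..E, (g x + g (-x)) * ρ x = 2 * ∫ x in (-E)..E, g x * ρ x := by
    simp only [add_mul]
    rw [intervalIntegral.integral_add i1 i2, h.integral_mul_comp_neg]
    ring
  have i3 : IntervalIntegrable (fun x => (g x + g (-x)) * ρ x) volume (-E) E := by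
    simpa only [add_mul] using i1.add i2
  suffices 0 < ∫ x in (-E)..E, (g x + g (-x)) * ρ x by linarith
  have hnn : 0 ≤ᵐ[volume.restrict (Set.Ioc (-E) E)] fun x => (g x + g (-x)) * ρ x := by
    filter_upwards [ae_restrict_mem measurableSet_Ioc] with x hx
    exact mul_nonneg (hpos x (Set.Ioc_subset_Icc_self hx)).le (h.1 x)
  rw [intervalIntegral.integral_of_le hle]
  refine lt_of_le_of_ne (integral_nonneg_of_ae hnn) fun h0 => ?_
  have hz := (integral_eq_zero_iff_of_nonneg_ae hnn i3.1).1 h0.symm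
  have h1 := h.integral_eq_one hE hEpi
  rw [intervalIntegral.integral_of_le hle, integral_eq_zero_of_ae] at h1
  · exact zero_ne_one h1
  · filter_upwards [hz, ae_restrict_mem measurableSet_Ioc] with x hx hm
    exact (mul_eq_zero.1 hx).resolve_left (hpos x (Set.Ioc_subset_Icc_self hm)).ne'

end IsSymDensity

lemma sin_half_sub_pos {E θ x : ℝ} (hEpi : E < Real.pi) (hEθ : E < θ) (hθ : θ ≤ Real.pi)
    (hx : x ∈ Set.Icc (-E) E) : 0 < Real.sin ((θ - x) / 2) :=
  sin_half_pos (by linarith [hx.2]) (by linarith [hx.1])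

lemma continuousOn_imKernel_cot {E r θ : ℝ} (hEpi : E < Real.pi) (hr : 1 ≤ r) (hEθ : E < θ)
    (hθ : θ ≤ Real.pi) :
    ContinuousOn (fun x => imKernel r (Real.cot ((θ - x) / 2))) (Set.Icc (-E) E) := by
  have hc : ContinuousOn (fun x => Real.cot ((θ - x) / 2)) (Set.Icc (-E) E) := by
    simp only [Real.cot_eq_cos_div_sin]
    exact ContinuousOn.div (by fun_prop) (by fun_prop)
      fun x hx => (sin_half_sub_pos hEpi hEθ hθ hx).ne'
  unfold imKernel
  exact ContinuousOn.div (by fun_prop) (by fun_prop) fun x _ => (imKernel_den_pos hr _).ne'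

lemma cauchyTransformD_im {E r θ : ℝ} {ρ : ℝ → ℝ} (h : IsSymDensity E ρ) (hE : 0 < E)
    (hEpi : E < Real.pi) (hr : 1 ≤ r) (hEθ : E < θ) (hθ : θ ≤ Real.pi) :
    (cauchyTransformD ρ ((r : ℂ) * Complex.exp ((θ : ℂ) * Complex.I))).im =
      ∫ x in (-E)..E, imKernel r (Real.cot ((θ - x) / 2)) * ρ x := by
  have hle : -E ≤ E := by linarith
  unfold cauchyTransformD
  have hred := h.integral_mul_eq (𝕜 := ℂ) hE hEpi (fun x =>
    (Complex.exp ((x : ℂ) * Complex.I) + (r : ℂ) * Complex.exp ((θ : ℂ) * Complex.I)) /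
      (Complex.exp ((x : ℂ) * Complex.I) - (r : ℂ) * Complex.exp ((θ : ℂ) * Complex.I)))
  simp only [Complex.coe_algebraMap] at hred
  rw [hred]
  have hcont : ContinuousOn (fun x : ℝ =>
      (Complex.exp ((x : ℂ) * Complex.I) + (r : ℂ) * Complex.exp ((θ : ℂ) * Complex.I)) /
      (Complex.exp ((x : ℂ) * Complex.I) - (r : ℂ) * Complex.exp ((θ : ℂ) * Complex.I)))
      (Set.uIcc (-E) E) := by
    rw [Set.uIcc_of_le hle]
    refine ContinuousOn.div (by fun_prop) (by fun_prop) fun x hx => ?_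
    exact Complex.normSq_pos.1
      (normSq_exp_sub_pos hr (sin_half_sub_pos hEpi hEθ hθ hx).ne')
  have hρ := h.intervalIntegrable hE hEpi
  have hρc : IntervalIntegrable (fun x => (ρ x : ℂ)) volume (-E) E := ⟨hρ.1.ofReal, hρ.2.ofReal⟩
  have hint := hρc.continuousOn_mul hcont
  rw [← Complex.imCLM_apply, ← Complex.imCLM.intervalIntegral_comp_comm hint]
  refine intervalIntegral.integral_congr fun x hx => ?_
  rw [Set.uIcc_of_le hle] at hx
  simp only [Complex.imCLM_apply, Complex.im_mul_ofReal]
  rw [im_kernel_eq hr (sin_half_sub_pos hEpi hEθ hθ hx).ne']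

lemma cauchyTransformD_im_circle {E θ : ℝ} {ρ : ℝ → ℝ} (h : IsSymDensity E ρ) (hE : 0 < E)
    (hEpi : E < Real.pi) (hEθ : E < θ) (hθ : θ ≤ Real.pi) :
    (cauchyTransformD ρ (Complex.exp ((θ : ℂ) * Complex.I))).im =
      ∫ x in (-E)..E, Real.cot ((θ - x) / 2) * ρ x := by
  have := cauchyTransformD_im h hE hEpi le_rfl hEθ hθ
  simpa only [Complex.ofReal_one, one_mul, imKernel_one] using this

lemma continuousOn_cot {E θ : ℝ} (hEpi : E < Real.pi) (hEθ : E < θ) (hθ : θ ≤ Real.pi) :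
    ContinuousOn (fun x => Real.cot ((θ - x) / 2)) (Set.Icc (-E) E) := by
  simpa only [imKernel_one] using continuousOn_imKernel_cot hEpi le_rfl hEθ hθ

lemma cauchyTransformD_im_lt {E r θ : ℝ} {ρ : ℝ → ℝ} (h : IsSymDensity E ρ) (hE : 0 < E)
    (hEpi : E < Real.pi) (hr : 1 < r) (hEθ : E < θ) (hθ : θ < Real.pi) :
    (cauchyTransformD ρ ((r : ℂ) * Complex.exp ((θ : ℂ) * Complex.I))).im <
      (cauchyTransformD ρ (Complex.exp ((θ : ℂ) * Complex.I))).im := by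
  have hle : -E ≤ E := by linarith
  rw [cauchyTransformD_im h hE hEpi hr.le hEθ hθ.le,
    cauchyTransformD_im_circle h hE hEpi hEθ hθ.le, ← sub_pos]
  have c1 := continuousOn_cot hEpi hEθ hθ.le
  have c2 := continuousOn_imKernel_cot hEpi hr.le hEθ hθ.le
  have hρ := h.intervalIntegrable hE hEpi
  rw [← intervalIntegral.integral_sub
    (hρ.continuousOn_mul (by rwa [Set.uIcc_of_le hle]))
    (hρ.continuousOn_mul (by rwa [Set.uIcc_of_le hle]))]
  simp only [← sub_mul]
  refine h.integral_mul_pos hE hEpi (c1.sub c2) fun x hx => ?_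
  have h1 := cot_half_add_pos (a := θ - x) (b := θ - -x) (by linarith [hx.2])
    (by linarith [hx.1]) (by linarith)
  have h2 := imKernel_add_lt hr h1
  linarith

lemma cauchyTransformD_im_anti {E θ φ : ℝ} {ρ : ℝ → ℝ} (h : IsSymDensity E ρ) (hE : 0 < E)
    (hEpi : E < Real.pi) (hEθ : E < θ) (hθφ : θ ≤ φ) (hφ : φ ≤ Real.pi) :
    (cauchyTransformD ρ (Complex.exp ((φ : ℂ) * Complex.I))).im ≤
      (cauchyTransformD ρ (Complex.exp ((θ : ℂ) * Complex.I))).im := by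
  have hle : -E ≤ E := by linarith
  have hρ := h.intervalIntegrable hE hEpi
  rw [cauchyTransformD_im_circle h hE hEpi hEθ (hθφ.trans hφ),
    cauchyTransformD_im_circle h hE hEpi (hEθ.trans_le hθφ) hφ]
  have c1 := continuousOn_cot hEpi hEθ (hθφ.trans hφ)
  have c2 := continuousOn_cot hEpi (hEθ.trans_le hθφ) hφ
  refine intervalIntegral.integral_mono_on hle
    (hρ.continuousOn_mul (by rwa [Set.uIcc_of_le hle]))
    (hρ.continuousOn_mul (by rwa [Set.uIcc_of_le hle])) fun x hx => ?_
  exact mul_le_mul_of_nonneg_right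
    (cot_half_anti (by linarith [hx.2]) (by linarith) (by linarith [hx.1])) (h.1 x)

lemma cauchyTransformD_im_pi {E : ℝ} {ρ : ℝ → ℝ} (h : IsSymDensity E ρ) (hE : 0 < E)
    (hEpi : E < Real.pi) :
    (cauchyTransformD ρ (Complex.exp ((Real.pi : ℂ) * Complex.I))).im = 0 := by
  rw [cauchyTransformD_im_circle h hE hEpi hEpi le_rfl]
  have hneg := h.integral_mul_comp_neg fun x => Real.cot ((Real.pi - x) / 2)
  have hodd (x : ℝ) : Real.cot ((Real.pi - -x) / 2) = -Real.cot ((Real.pi - x) / 2) := by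
    have h1 : (Real.pi - x) / 2 = Real.pi / 2 - x / 2 := by ring
    have h2 : (Real.pi - -x) / 2 = Real.pi / 2 - -(x / 2) := by ring
    rw [h1, h2]
    simp only [Real.cot_eq_cos_div_sin, Real.cos_pi_div_two_sub, Real.sin_pi_div_two_sub,
      Real.sin_neg, Real.cos_neg, neg_div]
  simp only [hodd, neg_mul, intervalIntegral.integral_neg] at hneg
  linarith

/-- Let `0 < E < π`, `M > 0`, and let `ρ` be a symmetric probability density
supported in `[−E, E]` with either `ρ ≤ M` a.e. or `E < π/8`. Then:
(i) for every `ε > 0` there is `c_ε > 0` depending only on `E, M, ε` such that for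
`0 < r − 1 < c_ε` and `E < θ < π − ε`, `Im f_ρ(r·e^{iθ}) < Im f_ρ(e^{iθ})`;
(ii) for `E < θ ≤ φ ≤ π`, `0 ≤ Im f_ρ(e^{iφ}) ≤ Im f_ρ(e^{iθ})`. -/
theorem stmt_3 (E M : ℝ) (hE : 0 < E) (hEpi : E < Real.pi) (hM : 0 < M) :
    (∀ ε : ℝ, 0 < ε → ∃ c : ℝ, 0 < c ∧
      ∀ ρ : ℝ → ℝ, IsSymDensity E ρ →
        ((∀ᵐ x ∂(volume : Measure ℝ), ρ x ≤ M) ∨ E < Real.pi / 8) →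
        ∀ r θ : ℝ, 0 < r - 1 → r - 1 < c → E < θ → θ < Real.pi - ε →
          (cauchyTransformD ρ ((r : ℂ) * Complex.exp ((θ : ℂ) * Complex.I))).im <
            (cauchyTransformD ρ (Complex.exp ((θ : ℂ) * Complex.I))).im) ∧
    (∀ ρ : ℝ → ℝ, IsSymDensity E ρ →
      ((∀ᵐ x ∂(volume : Measure ℝ), ρ x ≤ M) ∨ E < Real.pi / 8) →
      ∀ θ φ : ℝ, E < θ → θ ≤ φ → φ ≤ Real.pi →
        0 ≤ (cauchyTransformD ρ (Complex.exp ((φ : ℂ) * Complex.I))).im ∧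
          (cauchyTransformD ρ (Complex.exp ((φ : ℂ) * Complex.I))).im ≤
            (cauchyTransformD ρ (Complex.exp ((θ : ℂ) * Complex.I))).im) := by
  refine ⟨fun ε hε => ⟨1, one_pos, fun ρ h _ r θ hr _ hEθ hθ => ?_⟩,
    fun ρ h _ θ φ hEθ hθφ hφ => ⟨?_, cauchyTransformD_im_anti h hE hEpi hEθ hθφ hφ⟩⟩
  · exact cauchyTransformD_im_lt h hE hEpi (by linarith) hEθ (by linarith)
  · rw [← cauchyTransformD_im_pi h hE hEpi]
    exact cauchyTransformD_im_anti h hE hEpi (hEθ.trans_le hθφ) hφ le_rfl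

end
end

section
/- Let μ be a probability measure on the unit circle, let θ₀ ∈ ℝ and m > 0 with μ({e^{iθ₀}}) ≥ m. Then for every z = r·e^{iθ} with r > 1 and |θ − θ₀| < r − 1 one has −Re f_μ(z) ≥ m/(r − 1). -/
open MeasureTheory

noncomputable section

/-- On the unit circle the real part of the kernel is minus a Poisson kernel. -/
theorem neg_re_add_div_sub (u : Circle) (z : ℂ) :
    -(((u : ℂ) + z) / ((u : ℂ) - z)).re = (Complex.normSq z - 1) / Complex.normSq ((u : ℂ) - z) := by
  have hu : (u : ℂ).re * (u : ℂ).re + (u : ℂ).im * (u : ℂ).im = 1 := by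
    rw [← Complex.normSq_apply, Circle.normSq_coe]
  rw [Complex.div_re, ← add_div, ← neg_div]
  congr 1
  simp only [Complex.add_re, Complex.sub_re, Complex.add_im, Complex.sub_im, Complex.normSq_apply]
  linarith

theorem normSq_exp_sub_mul_exp (r a b : ℝ) :
    Complex.normSq ((Circle.exp a : ℂ) - (r : ℂ) * Complex.exp ((b : ℂ) * Complex.I))
      = (r - 1) ^ 2 + 2 * r * (1 - Real.cos (b - a)) := by
  rw [Circle.coe_exp, Complex.normSq_apply, Real.cos_sub]
  simp only [Complex.sub_re, Complex.sub_im, Complex.re_ofReal_mul, Complex.im_ofReal_mul,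
    Complex.exp_ofReal_mul_I_re, Complex.exp_ofReal_mul_I_im]
  linear_combination Real.sin_sq_add_cos_sq a + r ^ 2 * Real.sin_sq_add_cos_sq b

/-- If `μ` is a probability measure on the unit circle with an atom of mass
at least `m > 0` at `e^{iθ₀}`, then for every `z = r·e^{iθ}` with `r > 1` and
`|θ − θ₀| < r − 1` one has `−Re f_μ(z) ≥ m/(r − 1)`. -/
theorem stmt_4 (μ : Measure Circle) [IsProbabilityMeasure μ] (θ₀ m : ℝ) (hm : 0 < m)
    (hatom : ENNReal.ofReal m ≤ μ {Circle.exp θ₀}) (r θ : ℝ) (hr : 1 < r)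
    (hθ : |θ - θ₀| < r - 1) :
    m / (r - 1) ≤ -(cauchyTransform μ ((r : ℂ) * Complex.exp ((θ : ℂ) * Complex.I))).re := by
  have hr0 : 0 < r - 1 := sub_pos.2 hr
  set z : ℂ := (r : ℂ) * Complex.exp ((θ : ℂ) * Complex.I) with hz
  have hzn : ‖z‖ = r := by
    rw [hz, norm_mul, Complex.norm_exp_ofReal_mul_I, mul_one, Complex.norm_real, Real.norm_eq_abs,
      abs_of_pos (by linarith)]
  have hzsq : Complex.normSq z = r ^ 2 := by rw [Complex.normSq_eq_norm_sq, hzn]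
  have hne (u : Circle) : (u : ℂ) - z ≠ 0 := fun h => by
    have := congrArg norm (sub_eq_zero.1 h)
    rw [Circle.norm_coe, hzn] at this
    linarith
  have hcont : Continuous fun u : Circle => ((u : ℂ) + z) / ((u : ℂ) - z) :=
    (by fun_prop : Continuous fun u : Circle => (u : ℂ) + z).div
      (by fun_prop) hne
  have hint : Integrable (fun u : Circle => ((u : ℂ) + z) / ((u : ℂ) - z)) μ :=
    hcont.integrable_of_hasCompactSupport (.of_compactSpace _)
  have hintP : Integrable (fun u : Circle => -(((u : ℂ) + z) / ((u : ℂ) - z)).re) μ :=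
    hint.re.neg
  have hnonneg (u : Circle) : 0 ≤ -(((u : ℂ) + z) / ((u : ℂ) - z)).re := by
    rw [neg_re_add_div_sub, hzsq]
    exact div_nonneg (by nlinarith) (Complex.normSq_nonneg _)
  have hmass : m ≤ μ.real {Circle.exp θ₀} :=
    (ENNReal.ofReal_le_iff_le_toReal (measure_ne_top _ _)).1 hatom
  have hpoint : 1 / (r - 1) ≤
      -(((Circle.exp θ₀ : ℂ) + z) / ((Circle.exp θ₀ : ℂ) - z)).re := by
    have hpos := Complex.normSq_pos.2 (hne (Circle.exp θ₀))
    rw [neg_re_add_div_sub, hzsq, div_le_div_iff₀ hr0 hpos, hz, normSq_exp_sub_mul_exp]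
    have hcos := Real.one_sub_sq_div_two_le_cos (x := θ - θ₀)
    have hsq : (θ - θ₀) ^ 2 ≤ (r - 1) ^ 2 := sq_le_sq' (by linarith [(abs_lt.1 hθ).1])
      (abs_lt.1 hθ).2.le
    nlinarith [mul_le_mul_of_nonneg_left
      (show 2 * (1 - Real.cos (θ - θ₀)) ≤ (r - 1) ^ 2 by linarith) (by linarith : 0 ≤ r)]
  calc m / (r - 1) = m * (1 / (r - 1)) := by ring
    _ ≤ μ.real {Circle.exp θ₀} *
        -(((Circle.exp θ₀ : ℂ) + z) / ((Circle.exp θ₀ : ℂ) - z)).re :=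
      mul_le_mul hmass hpoint (by positivity) measureReal_nonneg
    _ = ∫ u in {Circle.exp θ₀}, -(((u : ℂ) + z) / ((u : ℂ) - z)).re ∂μ := by
      rw [integral_singleton, smul_eq_mul]
    _ ≤ ∫ u, -(((u : ℂ) + z) / ((u : ℂ) - z)).re ∂μ :=
      setIntegral_le_integral hintP (.of_forall hnonneg)
    _ = -(cauchyTransform μ z).re := by
      rw [integral_neg, cauchyTransform]
      exact congrArg Neg.neg (integral_re hint)

end
end

section
/- Fix 0 < Δ < 1/100 and set Θ := π − Δ/2. Let C₁ > 0 and let ρ be a probability density on [−π,π] with ρ(x) = ρ(−x), supported in [−Θ,Θ], satisfying C₁^{−1}√x ≤ Δ^{1/6}·ρ(Θ−x) ≤ C₁√x for 0 < x < Δ and C₁^{−1}x^{1/3} ≤ ρ(Θ−x) ≤ C₁x^{1/3} for Δ < x < Θ. Then there exists a constant C > 0, depending only on C₁, such that for every z = (1+η)·e^{i(Θ+κ)} with 0 < η < Δ and 0 < κ < π − Θ one has C^{−1}·η/√(η+κ) ≤ Δ^{1/6}·(−Re f_ρ(z)) ≤ C·η/√(η+κ). -/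
noncomputable section

/-- `ρ` is a symmetric probability density on `[−π, π]` supported in `[−Θ, Θ]` with
`Θ = π − Δ/2`, with square-root behavior on scale `Δ^{1/6}` at distance `< Δ` from the
edge and cube-root behavior further away, with constant `C₁`. -/
def IsCuspDensity (Δ C₁ : ℝ) (ρ : ℝ → ℝ) : Prop :=
  (∀ x, 0 ≤ ρ x) ∧ (∫ x in (-Real.pi)..Real.pi, ρ x) = 1 ∧ (∀ x, ρ x = ρ (-x)) ∧
    (∀ x, Real.pi - Δ / 2 < |x| → ρ x = 0) ∧
    (∀ x, 0 < x → x < Δ →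
      C₁⁻¹ * Real.sqrt x ≤ Δ ^ ((1 : ℝ) / 6) * ρ (Real.pi - Δ / 2 - x) ∧
        Δ ^ ((1 : ℝ) / 6) * ρ (Real.pi - Δ / 2 - x) ≤ C₁ * Real.sqrt x) ∧
    (∀ x, Δ < x → x < Real.pi - Δ / 2 →
      C₁⁻¹ * x ^ ((1 : ℝ) / 3) ≤ ρ (Real.pi - Δ / 2 - x) ∧
        ρ (Real.pi - Δ / 2 - x) ≤ C₁ * x ^ ((1 : ℝ) / 3))

/-- The exterior Poisson kernel of the unit circle at a point of modulus `1 + η` and angle `t`. -/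
def exteriorPoisson (η t : ℝ) : ℝ :=
  ((1 + η) ^ 2 - 1) / (1 + (1 + η) ^ 2 - 2 * (1 + η) * Real.cos t)

lemma exteriorPoisson_denom_pos {η : ℝ} (hη : 0 < η) (t : ℝ) :
    0 < 1 + (1 + η) ^ 2 - 2 * (1 + η) * Real.cos t := by
  nlinarith [mul_nonneg (by positivity : (0 : ℝ) ≤ 1 + η) (sub_nonneg.2 (Real.cos_le_one t)),
    mul_pos hη hη]

lemma exteriorPoisson_nonneg {η : ℝ} (hη : 0 < η) (t : ℝ) : 0 ≤ exteriorPoisson η t :=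
  div_nonneg (by nlinarith) (exteriorPoisson_denom_pos hη t).le

lemma continuous_exteriorPoisson {η : ℝ} (hη : 0 < η) : Continuous (exteriorPoisson η) := by
  unfold exteriorPoisson
  exact continuous_const.div (by fun_prop) fun t => (exteriorPoisson_denom_pos hη t).ne'

lemma exteriorPoisson_add_le_sub {η φ θ : ℝ} (hη : 0 < η) (hφ : 0 ≤ Real.sin φ)
    (hθ : 0 ≤ Real.sin θ) : exteriorPoisson η (φ + θ) ≤ exteriorPoisson η (φ - θ) := by
  have h : Real.cos (φ + θ) ≤ Real.cos (φ - θ) := by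
    rw [Real.cos_add, Real.cos_sub]
    nlinarith [mul_nonneg hφ hθ]
  unfold exteriorPoisson
  apply div_le_div_of_nonneg_left (by nlinarith) (exteriorPoisson_denom_pos hη _)
  nlinarith

lemma exteriorPoisson_le {η t : ℝ} (hη : 0 < η) (hη1 : η ≤ 1) (ht0 : 0 ≤ t)
    (ht : t ≤ Real.pi) : exteriorPoisson η t ≤ 15 * η / (η + t) ^ 2 := by
  have hc := Real.cos_le_one_sub_mul_cos_sq (x := t) (by rw [abs_of_nonneg ht0]; exact ht)
  have hpi : Real.pi ^ 2 ≤ 10 := by nlinarith [Real.pi_lt_d2, Real.pi_pos]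
  have h5 : 1 / 5 ≤ 2 / Real.pi ^ 2 := by
    rw [div_le_div_iff₀ (by norm_num) (by positivity)]; linarith
  have hc' : Real.cos t ≤ 1 - 1 / 5 * t ^ 2 := by nlinarith [sq_nonneg t]
  have hD := exteriorPoisson_denom_pos hη t
  have hD' : (η + t) ^ 2 / 5 ≤ 1 + (1 + η) ^ 2 - 2 * (1 + η) * Real.cos t := by
    nlinarith [mul_le_mul_of_nonneg_left hc' (by positivity : (0 : ℝ) ≤ 2 * (1 + η)),
      sq_nonneg (η - t), mul_nonneg hη.le (sq_nonneg t), sq_nonneg η]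
  unfold exteriorPoisson
  rw [div_le_div_iff₀ hD (by positivity)]
  calc ((1 + η) ^ 2 - 1) * (η + t) ^ 2 ≤ (3 * η) * (η + t) ^ 2 := by
        apply mul_le_mul_of_nonneg_right _ (sq_nonneg _); nlinarith
    _ ≤ _ := by nlinarith

lemma le_exteriorPoisson {η t : ℝ} (hη : 0 < η) (hη1 : η ≤ 1) :
    2 * η / (η ^ 2 + 2 * t ^ 2) ≤ exteriorPoisson η t := by
  have hD := exteriorPoisson_denom_pos hη t
  have hc := Real.one_sub_sq_div_two_le_cos (x := t)
  unfold exteriorPoisson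
  apply div_le_div₀ (by nlinarith) (by nlinarith) hD
  nlinarith [mul_le_mul_of_nonneg_left hc (by positivity : (0 : ℝ) ≤ 2 * (1 + η)),
    mul_le_mul_of_nonneg_right hη1 (sq_nonneg t)]

lemma neg_re_cauchy_kernel (η φ θ : ℝ) :
    -((Complex.exp ((θ : ℂ) * Complex.I) + ((1 + η : ℝ) : ℂ) * Complex.exp ((φ : ℂ) * Complex.I)) /
      (Complex.exp ((θ : ℂ) * Complex.I) -
        ((1 + η : ℝ) : ℂ) * Complex.exp ((φ : ℂ) * Complex.I))).re =
      exteriorPoisson η (φ - θ) := by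
  have h : Complex.normSq (Complex.exp ((θ : ℂ) * Complex.I) -
      ((1 + η : ℝ) : ℂ) * Complex.exp ((φ : ℂ) * Complex.I)) =
      1 + (1 + η) ^ 2 - 2 * (1 + η) * Real.cos (φ - θ) := by
    rw [Complex.normSq_apply]
    simp only [Complex.sub_re, Complex.sub_im, Complex.re_ofReal_mul, Complex.im_ofReal_mul,
      Complex.exp_ofReal_mul_I_re, Complex.exp_ofReal_mul_I_im, Real.cos_sub]
    linear_combination Real.sin_sq_add_cos_sq θ + (1 + η) ^ 2 * Real.sin_sq_add_cos_sq φ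
  rw [Complex.div_re, h, ← add_div, ← neg_div, exteriorPoisson]
  congr 1
  simp only [Complex.sub_re, Complex.sub_im, Complex.add_re, Complex.add_im,
    Complex.re_ofReal_mul, Complex.im_ofReal_mul,
    Complex.exp_ofReal_mul_I_re, Complex.exp_ofReal_mul_I_im]
  linear_combination -Real.sin_sq_add_cos_sq θ + (1 + η) ^ 2 * Real.sin_sq_add_cos_sq φ

lemma neg_re_cauchyTransformD {ρ : ℝ → ℝ} {η : ℝ} (φ : ℝ) (hη : 0 < η)
    (hρ : IntervalIntegrable ρ MeasureTheory.volume (-Real.pi) Real.pi) :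
    -(cauchyTransformD ρ (((1 + η : ℝ) : ℂ) * Complex.exp ((φ : ℂ) * Complex.I))).re =
      ∫ θ in (-Real.pi)..Real.pi, exteriorPoisson η (φ - θ) * ρ θ := by
  have hne : ∀ θ : ℝ, Complex.exp ((θ : ℂ) * Complex.I) -
      ((1 + η : ℝ) : ℂ) * Complex.exp ((φ : ℂ) * Complex.I) ≠ 0 := by
    intro θ h
    have h2 := congrArg (fun w : ℂ => ‖w‖) (sub_eq_zero.1 h)
    simp only [norm_mul, Complex.norm_exp_ofReal_mul_I, Complex.norm_real, Real.norm_eq_abs,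
      mul_one] at h2
    rw [abs_of_pos (by linarith)] at h2
    linarith
  have hcont : Continuous fun θ : ℝ => (Complex.exp ((θ : ℂ) * Complex.I) +
      ((1 + η : ℝ) : ℂ) * Complex.exp ((φ : ℂ) * Complex.I)) /
      (Complex.exp ((θ : ℂ) * Complex.I) -
        ((1 + η : ℝ) : ℂ) * Complex.exp ((φ : ℂ) * Complex.I)) :=
    Continuous.div (by fun_prop) (by fun_prop) hne
  have hint := (show IntervalIntegrable (fun θ => (ρ θ : ℂ)) MeasureTheory.volume (-Real.pi) Real.pi from
    ⟨hρ.1.ofReal, hρ.2.ofReal⟩).continuousOn_mul hcont.continuousOn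
  have hre := Complex.reCLM.intervalIntegral_comp_comm hint
  simp only [Complex.reCLM_apply] at hre
  unfold cauchyTransformD
  refine (congrArg Neg.neg hre.symm).trans ?_
  rw [← intervalIntegral.integral_neg]
  refine intervalIntegral.integral_congr fun θ _ => ?_
  simp only [← neg_re_cauchy_kernel, Complex.re_mul_ofReal,
    neg_mul]

lemma integral_rpow_neg_three_halves_le {s b : ℝ} (hs : 0 < s) (hb : 0 ≤ b) :
    ∫ θ in (0 : ℝ)..b, (s + b - θ) ^ (-(3 / 2) : ℝ) ≤ 2 / Real.sqrt s := by
  rw [intervalIntegral.integral_comp_sub_left (fun u : ℝ => u ^ (-(3 / 2) : ℝ)) (s + b),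
    integral_rpow (Or.inr ⟨by norm_num, by
      rw [Set.uIcc_of_le (by linarith)]; intro h; linarith [h.1]⟩)]
  have h1 : s ^ (-(1 / 2) : ℝ) = 1 / Real.sqrt s := by
    rw [Real.rpow_neg hs.le, Real.sqrt_eq_rpow, one_div (s ^ (1 / 2 : ℝ))]
  have h2 : 0 ≤ (s + b) ^ (-(1 / 2) : ℝ) := by positivity
  rw [add_sub_cancel_right, sub_zero, show (-(3 / 2) + 1 : ℝ) = -(1 / 2) by norm_num, h1]
  rw [show 2 / Real.sqrt s = 2 * (1 / Real.sqrt s) by ring]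
  linarith

lemma sqrt_div_sq_le_rpow {s x : ℝ} (hs : 0 < s) (hx : 0 ≤ x) :
    Real.sqrt x / (s + x) ^ 2 ≤ (s + x) ^ (-(3 / 2) : ℝ) := by
  have h : 0 < s + x := by linarith
  rw [div_le_iff₀ (by positivity), ← Real.rpow_natCast, ← Real.rpow_add h,
    show (-(3 / 2) + (2 : ℕ) : ℝ) = 1 / 2 by norm_num, ← Real.sqrt_eq_rpow]
  exact Real.sqrt_le_sqrt (by linarith)

lemma IsCuspDensity.intervalIntegrable {Δ C₁ : ℝ} {ρ : ℝ → ℝ} (h : IsCuspDensity Δ C₁ ρ) :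
    IntervalIntegrable ρ MeasureTheory.volume (-Real.pi) Real.pi := by
  by_contra hn
  have := h.2.1
  rw [intervalIntegral.integral_undef hn] at this
  norm_num at this

lemma IsCuspDensity.le_sqrt {Δ C₁ : ℝ} {ρ : ℝ → ℝ} (h : IsCuspDensity Δ C₁ ρ) (hΔ : 0 < Δ)
    (hC₁ : 0 < C₁) {θ : ℝ} (h0 : 0 < θ) (h1 : θ < Real.pi - Δ / 2)
    (hne : θ ≠ Real.pi - Δ / 2 - Δ) :
    Δ ^ ((1 : ℝ) / 6) * ρ θ ≤ C₁ * Real.sqrt (Real.pi - Δ / 2 - θ) := by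
  obtain ⟨-, -, -, -, hnear, hfar⟩ := h
  set x := Real.pi - Δ / 2 - θ with hx
  have hθ : θ = Real.pi - Δ / 2 - x := by rw [hx]; ring
  rcases lt_trichotomy x Δ with hlt | heq | hgt
  · rw [hθ]; exact (hnear x (by linarith) hlt).2
  · exact absurd (by linarith) hne
  · have := (hfar x hgt (by linarith)).2
    rw [← hθ] at this
    have hx0 : 0 < x := hΔ.trans hgt
    calc Δ ^ ((1 : ℝ) / 6) * ρ θ ≤ x ^ ((1 : ℝ) / 6) * (C₁ * x ^ ((1 : ℝ) / 3)) := by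
          apply mul_le_mul (Real.rpow_le_rpow hΔ.le hgt.le (by norm_num)) this
            (by rw [hθ]; refine le_trans ?_ (hfar x hgt (by linarith)).1; positivity)
            (by positivity)
      _ = C₁ * (x ^ ((1 : ℝ) / 6) * x ^ ((1 : ℝ) / 3)) := by ring
      _ = C₁ * Real.sqrt x := by
          rw [← Real.rpow_add hx0, Real.sqrt_eq_rpow]; norm_num

/-- By symmetry of `ρ`, the Poisson integral is at most twice its part over `[0, π]`. -/
lemma integral_exteriorPoisson_le_two_mul {ρ : ℝ → ℝ} {η φ : ℝ} (hη : 0 < η)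
    (hφ : 0 ≤ Real.sin φ) (hρ0 : ∀ x, 0 ≤ ρ x) (hsymm : ∀ x, ρ x = ρ (-x))
    (hρ : IntervalIntegrable ρ MeasureTheory.volume (-Real.pi) Real.pi) :
    ∫ θ in (-Real.pi)..Real.pi, exteriorPoisson η (φ - θ) * ρ θ ≤
      2 * ∫ θ in (0 : ℝ)..Real.pi, exteriorPoisson η (φ - θ) * ρ θ := by
  have hpi := Real.pi_pos
  have hP := continuous_exteriorPoisson hη
  have hL := hρ.mono_set (c := -Real.pi) (d := 0) (by
    rw [Set.uIcc_of_le (by linarith), Set.uIcc_of_le (by linarith)]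
    exact Set.Icc_subset_Icc le_rfl hpi.le)
  have hR := hρ.mono_set (c := 0) (d := Real.pi) (by
    rw [Set.uIcc_of_le (by linarith), Set.uIcc_of_le (by linarith)]
    exact Set.Icc_subset_Icc (by linarith) le_rfl)
  have hLi : IntervalIntegrable (fun θ => exteriorPoisson η (φ - θ) * ρ θ)
      MeasureTheory.volume (-Real.pi) 0 :=
    hL.continuousOn_mul (Continuous.continuousOn (by fun_prop))
  have hRi : IntervalIntegrable (fun θ => exteriorPoisson η (φ - θ) * ρ θ)
      MeasureTheory.volume 0 Real.pi :=
    hR.continuousOn_mul (Continuous.continuousOn (by fun_prop))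
  have hRi' : IntervalIntegrable (fun θ => exteriorPoisson η (φ + θ) * ρ θ)
      MeasureTheory.volume 0 Real.pi :=
    hR.continuousOn_mul (Continuous.continuousOn (by fun_prop))
  have hneg : ∫ θ in (-Real.pi)..0, exteriorPoisson η (φ - θ) * ρ θ =
      ∫ θ in (0 : ℝ)..Real.pi, exteriorPoisson η (φ + θ) * ρ θ := by
    have := intervalIntegral.integral_comp_neg (a := 0) (b := Real.pi)
      (fun θ => exteriorPoisson η (φ - θ) * ρ θ)
    simp only [sub_neg_eq_add, ← hsymm, neg_zero] at this
    exact this.symm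
  have hle : ∫ θ in (0 : ℝ)..Real.pi, exteriorPoisson η (φ + θ) * ρ θ ≤
      ∫ θ in (0 : ℝ)..Real.pi, exteriorPoisson η (φ - θ) * ρ θ := by
    refine intervalIntegral.integral_mono_on hpi.le hRi' hRi fun θ hθ => ?_
    exact mul_le_mul_of_nonneg_right (exteriorPoisson_add_le_sub hη hφ
      (Real.sin_nonneg_of_nonneg_of_le_pi hθ.1 hθ.2)) (hρ0 θ)
  rw [← intervalIntegral.integral_add_adjacent_intervals hLi hRi, hneg]
  linarith

lemma IsCuspDensity.integral_exteriorPoisson_le {Δ C₁ η κ : ℝ} {ρ : ℝ → ℝ}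
    (h : IsCuspDensity Δ C₁ ρ) (hC₁ : 0 < C₁) (hΔ : 0 < Δ) (hΔ1 : Δ < 1 / 100)
    (hη : 0 < η) (hηΔ : η < Δ) (hκ : 0 < κ) (hκΔ : κ < Δ / 2) :
    Δ ^ ((1 : ℝ) / 6) *
        ∫ θ in (-Real.pi)..Real.pi, exteriorPoisson η (Real.pi - Δ / 2 + κ - θ) * ρ θ ≤
      60 * C₁ * η / Real.sqrt (η + κ) := by
  have hpi := Real.pi_gt_three
  have hP := continuous_exteriorPoisson hη
  have hρ := h.intervalIntegrable
  set Θ := Real.pi - Δ / 2 with hΘ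
  have hΘ0 : 0 < Θ := by linarith
  have hΘpi : Θ < Real.pi := by linarith
  have htwo := integral_exteriorPoisson_le_two_mul (φ := Θ + κ) hη
    (Real.sin_nonneg_of_nonneg_of_le_pi (by linarith) (by linarith)) h.1 h.2.2.1 hρ
  have hint : ∀ c d : ℝ, 0 ≤ c → c ≤ d → d ≤ Real.pi →
      IntervalIntegrable (fun θ => exteriorPoisson η (Θ + κ - θ) * ρ θ)
        MeasureTheory.volume c d := by
    intro c d hc hcd hd
    refine (hρ.mono_set ?_).continuousOn_mul (Continuous.continuousOn (by fun_prop))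
    rw [Set.uIcc_of_le (by linarith), Set.uIcc_of_le (by linarith)]
    exact Set.Icc_subset_Icc (by linarith) hd
  have hzero : ∫ θ in Θ..Real.pi, exteriorPoisson η (Θ + κ - θ) * ρ θ = 0 := by
    refine intervalIntegral.integral_zero_ae (Filter.Eventually.of_forall fun θ hθ => ?_)
    rw [Set.uIoc_of_le hΘpi.le] at hθ
    rw [h.2.2.2.1 θ (lt_of_lt_of_le hθ.1 (le_abs_self θ)), mul_zero]
  have hsplit := intervalIntegral.integral_add_adjacent_intervals
    (hint 0 Θ le_rfl hΘ0.le hΘpi.le) (hint Θ Real.pi hΘ0.le hΘpi.le le_rfl)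
  rw [hzero, add_zero] at hsplit
  have hmain : ∫ θ in (0 : ℝ)..Θ, Δ ^ ((1 : ℝ) / 6) * (exteriorPoisson η (Θ + κ - θ) * ρ θ) ≤
      ∫ θ in (0 : ℝ)..Θ, 15 * C₁ * η * (η + κ + Θ - θ) ^ (-(3 / 2) : ℝ) := by
    have hg : IntervalIntegrable
        (fun θ => 15 * C₁ * η * (η + κ + Θ - θ) ^ (-(3 / 2) : ℝ)) MeasureTheory.volume 0 Θ := by
      apply ContinuousOn.intervalIntegrable
      apply continuousOn_const.mul
      apply ContinuousOn.rpow_const (by fun_prop)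
      intro θ hθ
      rw [Set.uIcc_of_le hΘ0.le] at hθ
      exact Or.inl (by linarith [hθ.2])
    refine intervalIntegral.integral_mono_ae_restrict hΘ0.le
      ((hint 0 Θ le_rfl hΘ0.le hΘpi.le).const_mul _) hg ?_
    rw [Filter.EventuallyLE, MeasureTheory.ae_restrict_iff' measurableSet_Icc]
    filter_upwards [MeasureTheory.Measure.ae_ne MeasureTheory.volume (0 : ℝ),
      MeasureTheory.Measure.ae_ne MeasureTheory.volume Θ,
      MeasureTheory.Measure.ae_ne MeasureTheory.volume (Θ - Δ)] with θ h0 h1 h2 hθ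
    have hθ0 : 0 < θ := lt_of_le_of_ne hθ.1 (Ne.symm h0)
    have hθ1 : θ < Θ := lt_of_le_of_ne hθ.2 h1
    have hb := h.le_sqrt hΔ hC₁ hθ0 hθ1 h2
    have hk := exteriorPoisson_le (t := Θ + κ - θ) hη (by linarith) (by linarith) (by linarith)
    have hs := sqrt_div_sq_le_rpow (s := η + κ) (x := Θ - θ) (by linarith) (by linarith)
    calc Δ ^ ((1 : ℝ) / 6) * (exteriorPoisson η (Θ + κ - θ) * ρ θ)
        = exteriorPoisson η (Θ + κ - θ) * (Δ ^ ((1 : ℝ) / 6) * ρ θ) := by ring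
      _ ≤ 15 * η / (η + (Θ + κ - θ)) ^ 2 * (C₁ * Real.sqrt (Θ - θ)) :=
          mul_le_mul hk hb (mul_nonneg (by positivity) (h.1 θ)) (by positivity)
      _ = 15 * C₁ * η * (Real.sqrt (Θ - θ) / (η + κ + (Θ - θ)) ^ 2) := by
          rw [show η + (Θ + κ - θ) = η + κ + (Θ - θ) by ring]; ring
      _ ≤ 15 * C₁ * η * (η + κ + Θ - θ) ^ (-(3 / 2) : ℝ) := by
          rw [add_sub_assoc]; gcongr
  rw [intervalIntegral.integral_const_mul, intervalIntegral.integral_const_mul] at hmain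
  have hI := integral_rpow_neg_three_halves_le (s := η + κ) (by linarith) hΘ0.le
  calc _ ≤ Δ ^ ((1 : ℝ) / 6) *
        (2 * ∫ θ in (0 : ℝ)..Θ, exteriorPoisson η (Θ + κ - θ) * ρ θ) := by
        rw [hsplit]; gcongr
    _ = 2 * (Δ ^ ((1 : ℝ) / 6) *
        ∫ θ in (0 : ℝ)..Θ, exteriorPoisson η (Θ + κ - θ) * ρ θ) := by ring
    _ ≤ 2 * (15 * C₁ * η * (2 / Real.sqrt (η + κ))) := by
        exact mul_le_mul_of_nonneg_left
          (hmain.trans (mul_le_mul_of_nonneg_left hI (by positivity))) (by norm_num)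
    _ = 60 * C₁ * η / Real.sqrt (η + κ) := by ring

lemma IsCuspDensity.le_integral_exteriorPoisson {Δ C₁ η κ : ℝ} {ρ : ℝ → ℝ}
    (h : IsCuspDensity Δ C₁ ρ) (hC₁ : 0 < C₁) (hΔ : 0 < Δ) (hΔ1 : Δ < 1 / 100)
    (hη : 0 < η) (hηΔ : η < Δ) (hκ : 0 < κ) (hκΔ : κ < Δ / 2) :
    (60 * C₁)⁻¹ * η / Real.sqrt (η + κ) ≤ Δ ^ ((1 : ℝ) / 6) *
        ∫ θ in (-Real.pi)..Real.pi, exteriorPoisson η (Real.pi - Δ / 2 + κ - θ) * ρ θ := by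
  have hpi := Real.pi_gt_three
  have hP := continuous_exteriorPoisson hη
  have hρ := h.intervalIntegrable
  set Θ := Real.pi - Δ / 2 with hΘ
  obtain ⟨s, hs⟩ : ∃ s, s = η + κ := ⟨_, rfl⟩
  have hs0 : 0 < s := by linarith
  rw [← hs]
  have hint : IntervalIntegrable
      (fun θ => Δ ^ ((1 : ℝ) / 6) * (exteriorPoisson η (Θ + κ - θ) * ρ θ))
        MeasureTheory.volume (-Real.pi) Real.pi :=
    (hρ.continuousOn_mul (Continuous.continuousOn (by fun_prop))).const_mul _
  have hmono := intervalIntegral.integral_mono_interval (c := -Real.pi) (d := Real.pi)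
    (a := Θ - s / 2) (b := Θ - s / 4) (by linarith) (by linarith) (by linarith)
    (Filter.Eventually.of_forall fun θ => mul_nonneg (by positivity)
      (mul_nonneg (exteriorPoisson_nonneg hη _) (h.1 θ))) hint
  have hconst : ∫ θ in (Θ - s / 2)..(Θ - s / 4),
      2 * η / (6 * s ^ 2) * (C₁⁻¹ * (Real.sqrt s / 2)) ≤
      ∫ θ in (Θ - s / 2)..(Θ - s / 4),
        Δ ^ ((1 : ℝ) / 6) * (exteriorPoisson η (Θ + κ - θ) * ρ θ) := by
    refine intervalIntegral.integral_mono_on (by linarith) intervalIntegrable_const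
      (hint.mono_set ?_) fun θ hθ => ?_
    · rw [Set.uIcc_of_le (by linarith), Set.uIcc_of_le (by linarith)]
      exact Set.Icc_subset_Icc (by linarith) (by linarith)
    have hb := (h.2.2.2.2.1 (Θ - θ) (by linarith [hθ.2]) (by linarith [hθ.1])).1
    rw [← hΘ, sub_sub_cancel] at hb
    have hk := le_exteriorPoisson (t := Θ + κ - θ) hη (by linarith)
    have hsq : Real.sqrt s / 2 ≤ Real.sqrt (Θ - θ) := by
      apply Real.le_sqrt_of_sq_le
      rw [div_pow, Real.sq_sqrt hs0.le]
      linarith [hθ.2]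
    have hden : η ^ 2 + 2 * (Θ + κ - θ) ^ 2 ≤ 6 * s ^ 2 := by
      have h1 : (Θ + κ - θ) ^ 2 ≤ (3 / 2 * s) ^ 2 :=
        pow_le_pow_left₀ (by linarith [hθ.2]) (by linarith [hθ.1]) 2
      have h2 : η ^ 2 ≤ s ^ 2 := pow_le_pow_left₀ hη.le (by linarith) 2
      nlinarith
    calc _ ≤ exteriorPoisson η (Θ + κ - θ) * (Δ ^ ((1 : ℝ) / 6) * ρ θ) := by
          apply mul_le_mul _ _ (by positivity) (exteriorPoisson_nonneg hη _)
          · exact le_trans (div_le_div_of_nonneg_left (by positivity) (by positivity) hden) hk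
          · exact le_trans (by gcongr) hb
      _ = _ := by ring
  rw [intervalIntegral.integral_const, smul_eq_mul] at hconst
  rw [← intervalIntegral.integral_const_mul]
  refine le_trans (le_trans ?_ hconst) hmono
  have hsq : Real.sqrt s ^ 2 = s := Real.sq_sqrt hs0.le
  have hq : 0 < Real.sqrt s := Real.sqrt_pos.2 hs0
  have heq : (Θ - s / 4 - (Θ - s / 2)) * (2 * η / (6 * s ^ 2) * (C₁⁻¹ * (Real.sqrt s / 2))) =
      (24 * C₁)⁻¹ * η / Real.sqrt s := by
    set q := Real.sqrt s
    rw [← hsq]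
    field_simp
    ring
  rw [heq]
  gcongr
  norm_num

/-- For a near-cusp density as above, there exists `C > 0`, depending
only on `C₁`, such that for `z = (1+η)·e^{i(Θ+κ)}` with `0 < η < Δ` and `0 < κ < π − Θ`,
`C⁻¹·η/√(η+κ) ≤ Δ^{1/6}·(−Re f_ρ(z)) ≤ C·η/√(η+κ)`. -/
theorem stmt_10 (C₁ : ℝ) (hC₁ : 0 < C₁) :
    ∃ C : ℝ, 0 < C ∧
      ∀ Δ : ℝ, 0 < Δ → Δ < 1 / 100 →
      ∀ ρ : ℝ → ℝ, IsCuspDensity Δ C₁ ρ →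
      ∀ η κ : ℝ, 0 < η → η < Δ → 0 < κ → κ < Real.pi - (Real.pi - Δ / 2) →
        C⁻¹ * η / Real.sqrt (η + κ) ≤
            Δ ^ ((1 : ℝ) / 6) *
              (-(cauchyTransformD ρ
                  (((1 + η : ℝ) : ℂ) *
                    Complex.exp (((Real.pi - Δ / 2 + κ : ℝ) : ℂ) * Complex.I))).re) ∧
          Δ ^ ((1 : ℝ) / 6) *
              (-(cauchyTransformD ρ
                  (((1 + η : ℝ) : ℂ) *
                    Complex.exp (((Real.pi - Δ / 2 + κ : ℝ) : ℂ) * Complex.I))).re) ≤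
            C * η / Real.sqrt (η + κ) := by
  refine ⟨60 * C₁, by positivity, fun Δ hΔ hΔ1 ρ h η κ hη hηΔ hκ hκΔ => ?_⟩
  rw [sub_sub_cancel] at hκΔ
  rw [neg_re_cauchyTransformD _ hη h.intervalIntegrable]
  exact ⟨h.le_integral_exteriorPoisson hC₁ hΔ hΔ1 hη hηΔ hκ hκΔ,
    h.integral_exteriorPoisson_le hC₁ hΔ hΔ1 hη hηΔ hκ hκΔ⟩

end
end

section
/- Let μ be a probability measure on the unit circle with Cauchy transform f_μ, let φ : ℝ → ℝ be a twice continuously differentiable 2π-periodic function, and let χ : (0,∞) → ℝ be smooth, supported in [1/2, 2], with χ ≡ 1 on [3/4, 4/3]. Then ∫_{−π}^{π} φ(θ) dμ(θ) = (1/4π)·∫_0^{2π}∫_0^∞ (φ(θ) − i·log(r)·φ'(θ))·χ'(r)·f_μ(r·e^{iθ}) dr dθ + (1/4π)·∫_0^{2π}∫_0^∞ φ''(θ)·log(r)·χ(r)·f_μ(r·e^{iθ})·r^{−1} dr dθ, where both double integrals converge absolutely (the integrands being interpreted as 0 at r = 1). -/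
open MeasureTheory

noncomputable section

open Filter Topology Set

/-- The kernel `(u + z) / (u - z)` of the Cauchy transform. -/
def cauchyKernel (u z : ℂ) : ℂ := (u + z) / (u - z)

/-- The point with polar coordinates `(r, θ)`, in exponential form. -/
def polarPoint (r θ : ℝ) : ℂ := (r : ℂ) * Complex.exp ((θ : ℂ) * Complex.I)

lemma norm_polarPoint (r θ : ℝ) : ‖polarPoint r θ‖ = |r| := by
  simp [polarPoint, Complex.norm_exp_ofReal_mul_I]

lemma continuous_polarPoint : Continuous fun p : ℝ × ℝ => polarPoint p.1 p.2 := by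
  unfold polarPoint; fun_prop

lemma continuous_polarPoint_angle (r : ℝ) : Continuous fun θ => polarPoint r θ := by
  unfold polarPoint; fun_prop

lemma abs_one_sub_le_norm_sub {u : ℂ} (hu : ‖u‖ = 1) {r : ℝ} (hr : 0 ≤ r) (θ : ℝ) :
    |1 - r| ≤ ‖u - polarPoint r θ‖ := by
  have h := abs_norm_sub_norm_le u (polarPoint r θ)
  rwa [hu, norm_polarPoint, abs_of_nonneg hr] at h

lemma sub_polarPoint_ne_zero {u : ℂ} (hu : ‖u‖ = 1) {r : ℝ} (hr : 0 ≤ r) (hr1 : r ≠ 1) (θ : ℝ) :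
    u - polarPoint r θ ≠ 0 := by
  rw [← norm_pos_iff]
  exact (abs_pos.2 (sub_ne_zero.2 hr1.symm)).trans_le (abs_one_sub_le_norm_sub hu hr θ)

lemma norm_sub_mul_norm_cauchyKernel_le {u : ℂ} (hu : ‖u‖ = 1) {r : ℝ} (hr : 0 ≤ r) (θ : ℝ) :
    ‖u - polarPoint r θ‖ * ‖cauchyKernel u (polarPoint r θ)‖ ≤ 1 + r := by
  have h1 : ‖u + polarPoint r θ‖ ≤ 1 + r := by
    refine (norm_add_le _ _).trans ?_
    rw [hu, norm_polarPoint, abs_of_nonneg hr]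
  rw [cauchyKernel, norm_div]
  rcases eq_or_ne ‖u - polarPoint r θ‖ 0 with h | h
  · rw [h, zero_mul]; positivity
  · rwa [mul_div_cancel₀ _ h]

lemma abs_one_sub_mul_norm_cauchyKernel_le {u : ℂ} (hu : ‖u‖ = 1) {r : ℝ} (hr : 0 ≤ r) (θ : ℝ) :
    |1 - r| * ‖cauchyKernel u (polarPoint r θ)‖ ≤ 1 + r :=
  (mul_le_mul_of_nonneg_right (abs_one_sub_le_norm_sub hu hr θ) (norm_nonneg _)).trans
    (norm_sub_mul_norm_cauchyKernel_le hu hr θ)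

lemma hasDerivAt_cauchyKernel {u z : ℂ} (h : u - z ≠ 0) :
    HasDerivAt (cauchyKernel u) (2 * u / (u - z) ^ 2) z := by
  have := ((hasDerivAt_id z).const_add u).div ((hasDerivAt_id z).const_sub u) h
  refine this.congr_deriv ?_
  simp only [id]
  congr 1
  ring

lemma hasDerivAt_polarPoint_radius (r θ : ℝ) :
    HasDerivAt (fun r => polarPoint r θ) (Complex.exp ((θ : ℂ) * Complex.I)) r := by
  simpa [polarPoint] using (Complex.ofRealCLM.hasDerivAt (x := r)).mul_const
    (Complex.exp ((θ : ℂ) * Complex.I))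

lemma hasDerivAt_polarPoint_angle (r θ : ℝ) :
    HasDerivAt (fun θ => polarPoint r θ)
      (Complex.I * (r * Complex.exp ((θ : ℂ) * Complex.I))) θ := by
  have := (((Complex.ofRealCLM.hasDerivAt (x := θ)).mul_const Complex.I).cexp).const_mul (r : ℂ)
  simp only [Complex.ofRealCLM_apply, Complex.ofReal_one, one_mul] at this
  exact this.congr_deriv (by ring)

/-- The integral of `ψ` against the kernel over the circle of radius `r`. -/
def kernelMoment (ψ : ℝ → ℝ) (u : ℂ) (r : ℝ) : ℂ :=
  ∫ θ in (0)..(2 * Real.pi), (ψ θ : ℂ) * cauchyKernel u (polarPoint r θ)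

lemma continuous_cauchyKernel_polarPoint {u : ℂ} (hu : ‖u‖ = 1) {r : ℝ} (hr : 0 ≤ r)
    (hr1 : r ≠ 1) : Continuous fun θ => cauchyKernel u (polarPoint r θ) := by
  have h : Continuous fun θ => polarPoint r θ := continuous_polarPoint_angle r
  exact (continuous_const.add h).div (continuous_const.sub h)
    fun θ => sub_polarPoint_ne_zero hu hr hr1 θ

lemma polarPoint_add_two_pi (r θ : ℝ) : polarPoint r (θ + 2 * Real.pi) = polarPoint r θ := by
  simp only [polarPoint]
  push_cast
  rw [add_mul, Complex.exp_add, Complex.exp_two_pi_mul_I, mul_one]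

lemma integral_angular_deriv {ψ : ℝ → ℝ} (hψ : ContDiff ℝ 1 ψ)
    (hper : Function.Periodic ψ (2 * Real.pi)) {u : ℂ} (hu : ‖u‖ = 1) {r : ℝ} (hr : 0 < r)
    (hr1 : r ≠ 1) :
    ∫ θ in (0)..(2 * Real.pi), (ψ θ : ℂ) * (2 * u / (u - polarPoint r θ) ^ 2 *
      Complex.exp ((θ : ℂ) * Complex.I)) = Complex.I / r * kernelMoment (deriv ψ) u r := by
  have hne := sub_polarPoint_ne_zero hu hr.le hr1
  have hP : Continuous fun θ => polarPoint r θ := continuous_polarPoint_angle r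
  have hparts := intervalIntegral.integral_mul_deriv_eq_deriv_mul
    (a := 0) (b := 2 * Real.pi) (u := fun θ => (ψ θ : ℂ)) (u' := fun θ => ((deriv ψ θ : ℝ) : ℂ))
    (v := fun θ => cauchyKernel u (polarPoint r θ))
    (v' := fun θ => 2 * u / (u - polarPoint r θ) ^ 2 *
      (Complex.I * (r * Complex.exp ((θ : ℂ) * Complex.I))))
    (fun θ _ => ((hψ.differentiable one_ne_zero θ).hasDerivAt).ofReal_comp)
    (fun θ _ => (hasDerivAt_cauchyKernel (hne θ)).comp θ (hasDerivAt_polarPoint_angle r θ))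
    ((Complex.continuous_ofReal.comp (hψ.continuous_deriv le_rfl)).intervalIntegrable _ _)
    (Continuous.intervalIntegrable (((continuous_const.div ((continuous_const.sub hP).pow 2)
      fun θ => pow_ne_zero 2 (hne θ))).mul (by fun_prop)) _ _)
  have h0 : ψ (2 * Real.pi) = ψ 0 := by simpa using hper 0
  have h1 : polarPoint r (2 * Real.pi) = polarPoint r 0 := by
    simpa using polarPoint_add_two_pi r 0
  simp only [h0, h1, sub_self, zero_sub] at hparts
  have hrc : (r : ℂ) ≠ 0 := by exact_mod_cast hr.ne'
  rw [kernelMoment, ← neg_eq_iff_eq_neg.2 hparts, ← intervalIntegral.integral_neg,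
    ← intervalIntegral.integral_const_mul]
  refine intervalIntegral.integral_congr fun θ _ => ?_
  linear_combination ((ψ θ : ℂ) * (2 * u / (u - polarPoint r θ) ^ 2 *
    Complex.exp ((θ : ℂ) * Complex.I))) *
      ((r * (r : ℂ)⁻¹) * Complex.I_sq - mul_inv_cancel₀ hrc)

lemma hasDerivAt_kernelMoment {ψ : ℝ → ℝ} (hψ : ContDiff ℝ 1 ψ)
    (hper : Function.Periodic ψ (2 * Real.pi)) {u : ℂ} (hu : ‖u‖ = 1) {r : ℝ} (hr : 0 < r)
    (hr1 : r ≠ 1) :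
    HasDerivAt (kernelMoment ψ u) (Complex.I / r * kernelMoment (deriv ψ) u r) r := by
  rw [← integral_angular_deriv hψ hper hu hr hr1]
  have hne := sub_polarPoint_ne_zero hu hr.le hr1
  have hP : Continuous fun θ => polarPoint r θ := continuous_polarPoint_angle r
  have hψc : Continuous fun θ => (ψ θ : ℂ) := Complex.continuous_ofReal.comp hψ.continuous
  have hd : 0 < |1 - r| / 2 := half_pos (abs_pos.2 (sub_ne_zero.2 hr1.symm))
  have hs : {x : ℝ | 0 < x ∧ |1 - r| / 2 < |1 - x|} ∈ 𝓝 r := by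
    refine IsOpen.mem_nhds ?_ ⟨hr, by linarith⟩
    exact (isOpen_lt continuous_const continuous_id).inter
      (isOpen_lt continuous_const (continuous_const.sub continuous_id).abs)
  have hs1 : ∀ x ∈ {x : ℝ | 0 < x ∧ |1 - r| / 2 < |1 - x|}, x ≠ 1 := by
    rintro x hx rfl
    have := hx.2
    simp only [sub_self, abs_zero] at this
    linarith
  refine (intervalIntegral.hasDerivAt_integral_of_dominated_loc_of_deriv_le
    (F := fun x θ => (ψ θ : ℂ) * cauchyKernel u (polarPoint x θ))
    (F' := fun x θ => (ψ θ : ℂ) * (2 * u / (u - polarPoint x θ) ^ 2 *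
      Complex.exp ((θ : ℂ) * Complex.I)))
    (bound := fun θ => ‖(ψ θ : ℂ)‖ * (2 / (|1 - r| / 2) ^ 2))
    hs ?_ ?_ ?_ ?_ ?_ ?_).2
  · filter_upwards [hs] with x hx
    exact (hψc.mul (continuous_cauchyKernel_polarPoint hu hx.1.le
      (hs1 x hx))).aestronglyMeasurable
  · exact (hψc.mul (continuous_cauchyKernel_polarPoint hu hr.le hr1)).intervalIntegrable _ _
  · exact (hψc.mul (((continuous_const.div ((continuous_const.sub hP).pow 2)
      fun θ => pow_ne_zero 2 (hne θ))).mul (by fun_prop))).aestronglyMeasurable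
  · refine ae_of_all _ fun θ _ x hx => ?_
    rw [norm_mul, norm_mul, Complex.norm_exp_ofReal_mul_I, mul_one, norm_div, norm_mul, hu,
      norm_pow, Complex.norm_ofNat, mul_one]
    have := hx.2.le.trans (abs_one_sub_le_norm_sub hu hx.1.le θ)
    gcongr
  · exact (hψc.norm.mul continuous_const).intervalIntegrable _ _
  · refine ae_of_all _ fun θ _ x hx => ?_
    exact ((hasDerivAt_cauchyKernel (sub_polarPoint_ne_zero hu hx.1.le (hs1 x hx) θ)).comp x
      (hasDerivAt_polarPoint_radius x θ)).const_mul _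

lemma integral_cauchyKernel_of_lt_one {u : ℂ} (hu : ‖u‖ = 1) {r : ℝ} (hr : 0 ≤ r) (hr1 : r < 1) :
    ∫ θ in (0)..(2 * Real.pi), cauchyKernel u (polarPoint r θ) = 2 * Real.pi := by
  have hd : DiffContOnCl ℂ (cauchyKernel u) (Metric.ball 0 |r|) := by
    refine DifferentiableOn.diffContOnCl fun z hz => ?_
    have hz' : ‖z‖ ≤ r := by
      simpa [abs_of_nonneg hr] using Metric.closure_ball_subset_closedBall hz
    refine (hasDerivAt_cauchyKernel ?_).differentiableAt.differentiableWithinAt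
    intro h
    rw [← sub_eq_zero.1 h, hu] at hz'
    linarith
  have h := hd.circleAverage
  have hu0 : u ≠ 0 := norm_ne_zero_iff.1 (by rw [hu]; exact one_ne_zero)
  have hpi : (0 : ℝ) < 2 * Real.pi := by positivity
  rw [Real.circleAverage_def, inv_smul_eq_iff₀ hpi.ne'] at h
  simpa [circleMap, polarPoint, cauchyKernel, hu0] using h

lemma cauchyKernel_polarPoint_inv {u : ℂ} (hu : ‖u‖ = 1) {r : ℝ} (hr : 0 < r) (hr1 : r ≠ 1)
    (θ : ℝ) : cauchyKernel u (polarPoint r θ) =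
      -(starRingEnd ℂ) (cauchyKernel u (polarPoint r⁻¹ θ)) := by
  have h1 := sub_polarPoint_ne_zero hu hr.le hr1 θ
  have h2 := (map_ne_zero (starRingEnd ℂ)).2 (sub_polarPoint_ne_zero hu (inv_nonneg.2 hr.le)
    (fun h => hr1 (inv_eq_one.1 h)) θ)
  have hrc : (r : ℂ) ≠ 0 := by exact_mod_cast hr.ne'
  have hrr : (r : ℂ) * (r : ℂ)⁻¹ = 1 := mul_inv_cancel₀ hrc
  have huu : u * (starRingEnd ℂ) u = 1 := by rw [Complex.mul_conj']; simp [hu]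
  have hee : Complex.exp ((θ : ℂ) * Complex.I) *
      (starRingEnd ℂ) (Complex.exp ((θ : ℂ) * Complex.I)) = 1 := by
    rw [Complex.mul_conj']; simp [Complex.norm_exp_ofReal_mul_I]
  simp only [cauchyKernel, polarPoint, map_div₀, map_add, map_sub, map_mul, Complex.conj_ofReal,
    Complex.ofReal_inv, map_inv₀] at h1 h2 ⊢
  rw [← neg_div, div_eq_div_iff h1 h2]
  linear_combination 2 * huu - 2 * (r * (r : ℂ)⁻¹) * hee - 2 * hrr

lemma integral_cauchyKernel_of_one_lt {u : ℂ} (hu : ‖u‖ = 1) {r : ℝ} (hr1 : 1 < r) :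
    ∫ θ in (0)..(2 * Real.pi), cauchyKernel u (polarPoint r θ) = -(2 * Real.pi) := by
  have hr : 0 < r := one_pos.trans hr1
  simp_rw [cauchyKernel_polarPoint_inv hu hr hr1.ne', intervalIntegral.integral_neg]
  rw [intervalIntegral.integral_of_le (by positivity), integral_conj,
    ← intervalIntegral.integral_of_le (by positivity),
    integral_cauchyKernel_of_lt_one hu (inv_nonneg.2 hr.le) (inv_lt_one_of_one_lt₀ hr1)]
  simp [Complex.conj_ofNat]

lemma abs_le_mul_norm_exp_sub_one {x : ℝ} (hx : |x| ≤ Real.pi) :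
    |x| ≤ Real.pi / 2 * ‖Complex.exp (Complex.I * x) - 1‖ := by
  have h := Real.mul_abs_le_abs_sin (x := x / 2) (by rw [abs_div, abs_two]; linarith)
  rw [Complex.norm_exp_I_mul_ofReal_sub_one, norm_mul, Real.norm_two, Real.norm_eq_abs]
  have hpi := Real.pi_pos
  rw [abs_div, abs_two] at h
  calc |x| = Real.pi * (2 / Real.pi * (|x| / 2)) := by field_simp
    _ ≤ Real.pi * |Real.sin (x / 2)| := by gcongr
    _ = _ := by ring

lemma periodic_deriv {ψ : ℝ → ℝ} {c : ℝ} (hper : Function.Periodic ψ c) :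
    Function.Periodic (deriv ψ) c := by
  intro x
  rw [← deriv_comp_add_const, show (fun x => ψ (x + c)) = ψ from funext hper]

lemma exists_lipschitz_of_periodic {ψ : ℝ → ℝ} (hψ : ContDiff ℝ 1 ψ)
    (hper : Function.Periodic ψ (2 * Real.pi)) :
    ∃ K, 0 ≤ K ∧ ∀ α θ : ℝ, |ψ θ - ψ α| ≤ K * ‖Complex.exp (α * Complex.I) - polarPoint 1 θ‖ := by
  obtain ⟨M, hM⟩ := isBounded_iff_forall_norm_le.1 ((periodic_deriv hper).isBounded_of_continuous
    Real.two_pi_pos.ne' (hψ.continuous_deriv le_rfl))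
  have hM' : ∀ x, ‖deriv ψ x‖ ≤ M := fun x => hM _ (mem_range_self x)
  have hM0 : 0 ≤ M := (norm_nonneg _).trans (hM' 0)
  refine ⟨M * (Real.pi / 2), by positivity, fun α θ => ?_⟩
  set x := toIocMod Real.two_pi_pos (-Real.pi) (θ - α) with hx
  have hxm := toIocMod_mem_Ioc Real.two_pi_pos (-Real.pi) (θ - α)
  rw [← hx] at hxm
  have hxabs : |x| ≤ Real.pi := abs_le.2 ⟨hxm.1.le, by linarith [hxm.2]⟩
  obtain ⟨n, hn⟩ : ∃ n : ℤ, θ = α + x + n * (2 * Real.pi) := by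
    refine ⟨toIocDiv Real.two_pi_pos (-Real.pi) (θ - α), ?_⟩
    have := toIocMod_add_toIocDiv_zsmul Real.two_pi_pos (-Real.pi) (θ - α)
    rw [← hx, zsmul_eq_mul] at this
    linarith
  have h1 : ψ θ = ψ (α + x) := by rw [hn]; exact hper.int_mul n (α + x)
  have h2 : polarPoint 1 θ = Complex.exp (α * Complex.I) * Complex.exp (Complex.I * x) := by
    rw [polarPoint, hn, ← Complex.exp_add, Complex.ofReal_one, one_mul, Complex.exp_eq_exp_iff_exists_int]
    exact ⟨n, by push_cast; ring⟩
  have h3 : ‖Complex.exp (α * Complex.I) - polarPoint 1 θ‖ =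
      ‖Complex.exp (Complex.I * x) - 1‖ := by
    rw [h2, ← mul_one_sub, norm_mul, Complex.norm_exp_ofReal_mul_I, one_mul, norm_sub_rev]
  have h4 := convex_univ.norm_image_sub_le_of_norm_deriv_le (f := ψ) (C := M) (x := α)
    (y := α + x) (fun x _ => hψ.differentiable one_ne_zero x) (fun x _ => hM' x)
    (mem_univ _) (mem_univ _)
  rw [h1, h3]
  simp only [Real.norm_eq_abs, add_sub_cancel_left] at h4
  calc _ ≤ M * |x| := h4
    _ ≤ M * (Real.pi / 2 * ‖Complex.exp (Complex.I * x) - 1‖) := by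
      gcongr; exact abs_le_mul_norm_exp_sub_one hxabs
    _ = _ := by ring

lemma norm_sub_polarPoint_one_le {u : ℂ} (hu : ‖u‖ = 1) {r : ℝ} (hr : 0 ≤ r) (θ : ℝ) :
    ‖u - polarPoint 1 θ‖ ≤ 2 * ‖u - polarPoint r θ‖ := by
  have h1 := abs_one_sub_le_norm_sub hu hr θ
  have h2 : ‖polarPoint r θ - polarPoint 1 θ‖ = |1 - r| := by
    rw [polarPoint, polarPoint, ← sub_mul, norm_mul, Complex.norm_exp_ofReal_mul_I, mul_one,
      ← Complex.ofReal_sub, Complex.norm_real, Real.norm_eq_abs, abs_sub_comm]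
  have h3 := norm_sub_le_norm_sub_add_norm_sub u (polarPoint r θ) (polarPoint 1 θ)
  linarith

lemma tendsto_integral_sub_mul_cauchyKernel {ψ : ℝ → ℝ} (hψ : ContDiff ℝ 1 ψ)
    (hper : Function.Periodic ψ (2 * Real.pi)) (α : ℝ) :
    ∃ L : ℂ, Tendsto (fun r => ∫ θ in (0)..(2 * Real.pi), ((ψ θ - ψ α : ℝ) : ℂ) *
      cauchyKernel (Complex.exp (α * Complex.I)) (polarPoint r θ)) (𝓝[≠] 1) (𝓝 L) := by
  obtain ⟨K, hK, hlip⟩ := exists_lipschitz_of_periodic hψ hper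
  set u := Complex.exp (α * Complex.I) with hu_def
  have hu : ‖u‖ = 1 := Complex.norm_exp_ofReal_mul_I α
  have hev : ∀ᶠ r : ℝ in 𝓝[≠] 1, 0 ≤ r ∧ r ≤ 2 ∧ r ≠ 1 := by
    filter_upwards [mem_nhdsWithin_of_mem_nhds (Icc_mem_nhds one_half_lt_one one_lt_two),
      self_mem_nhdsWithin] with r hr hr1
    exact ⟨by linarith [hr.1], hr.2, hr1⟩
  refine ⟨_, intervalIntegral.tendsto_integral_filter_of_dominated_convergence
    (fun _ => 6 * K) ?_ ?_ intervalIntegrable_const (ae_of_all _ fun θ _ => ?_) (f := fun θ =>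
      ((ψ θ - ψ α : ℝ) : ℂ) * cauchyKernel u (polarPoint 1 θ))⟩
  · filter_upwards [hev] with r hr
    exact ((Complex.continuous_ofReal.comp (hψ.continuous.sub continuous_const)).mul
      (continuous_cauchyKernel_polarPoint hu hr.1 hr.2.2)).aestronglyMeasurable
  · filter_upwards [hev] with r hr
    refine ae_of_all _ fun θ _ => ?_
    rw [norm_mul, Complex.norm_real, Real.norm_eq_abs]
    have h1 := norm_sub_mul_norm_cauchyKernel_le hu hr.1 θ
    calc |ψ θ - ψ α| * ‖cauchyKernel u (polarPoint r θ)‖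
        ≤ (K * (2 * ‖u - polarPoint r θ‖)) * ‖cauchyKernel u (polarPoint r θ)‖ := by
          gcongr
          exact (hlip α θ).trans (by gcongr; exact norm_sub_polarPoint_one_le hu hr.1 θ)
      _ = 2 * K * (‖u - polarPoint r θ‖ * ‖cauchyKernel u (polarPoint r θ)‖) := by ring
      _ ≤ 2 * K * 3 := by gcongr; linarith [hr.2.1]
      _ = 6 * K := by ring
  · by_cases h : u - polarPoint 1 θ = 0
    · have h0 : ψ θ - ψ α = 0 := by
        have := hlip α θ
        rw [← hu_def, h, norm_zero, mul_zero] at this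
        exact abs_nonpos_iff.1 this
      simp [h0]
    · exact (((hasDerivAt_cauchyKernel h).continuousAt.comp (f := fun r => polarPoint r θ)
        (hasDerivAt_polarPoint_radius 1 θ).continuousAt).tendsto.mono_left
          nhdsWithin_le_nhds).const_mul _

lemma kernelMoment_eq {ψ : ℝ → ℝ} (hψ : Continuous ψ) {u : ℂ} (hu : ‖u‖ = 1) {r : ℝ}
    (hr : 0 ≤ r) (hr1 : r ≠ 1) (c : ℝ) :
    kernelMoment ψ u r = (∫ θ in (0)..(2 * Real.pi), ((ψ θ - c : ℝ) : ℂ) *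
      cauchyKernel u (polarPoint r θ)) +
      c * ∫ θ in (0)..(2 * Real.pi), cauchyKernel u (polarPoint r θ) := by
  have hc := continuous_cauchyKernel_polarPoint hu hr hr1
  rw [kernelMoment, ← intervalIntegral.integral_const_mul, ← intervalIntegral.integral_add]
  · refine intervalIntegral.integral_congr fun θ _ => ?_
    push_cast
    ring
  · exact ((Complex.continuous_ofReal.comp (hψ.sub continuous_const)).mul
      hc).intervalIntegrable _ _
  · exact (continuous_const.mul hc).intervalIntegrable _ _

lemma exists_tendsto_kernelMoment {ψ : ℝ → ℝ} (hψ : ContDiff ℝ 1 ψ)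
    (hper : Function.Periodic ψ (2 * Real.pi)) (α : ℝ) :
    ∃ L : ℂ, Tendsto (kernelMoment ψ (Complex.exp (α * Complex.I))) (𝓝[<] 1)
        (𝓝 (L + ψ α * (2 * Real.pi))) ∧
      Tendsto (kernelMoment ψ (Complex.exp (α * Complex.I))) (𝓝[>] 1)
        (𝓝 (L + ψ α * (-(2 * Real.pi)))) := by
  obtain ⟨L, hL⟩ := tendsto_integral_sub_mul_cauchyKernel hψ hper α
  have hu := Complex.norm_exp_ofReal_mul_I α
  refine ⟨L, ?_, ?_⟩
  · refine ((hL.mono_left (nhdsWithin_mono _ fun x hx => ne_of_lt hx)).add_const _).congr' ?_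
    filter_upwards [Ioo_mem_nhdsLT one_pos] with r hr
    rw [kernelMoment_eq hψ.continuous hu hr.1.le hr.2.ne (ψ α),
      integral_cauchyKernel_of_lt_one hu hr.1.le hr.2]
  · refine ((hL.mono_left (nhdsWithin_mono _ fun x hx => ne_of_gt hx)).add_const _).congr' ?_
    filter_upwards [self_mem_nhdsWithin] with r hr
    have hr : 1 < r := hr
    rw [kernelMoment_eq hψ.continuous hu (by linarith) hr.ne' (ψ α),
      integral_cauchyKernel_of_one_lt hu hr]

/-- The radial density whose integral over `(0, ∞)` gives the right-hand side for `δ_u`. -/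
def radialDensity (φ χ : ℝ → ℝ) (u : ℂ) (r : ℝ) : ℂ :=
  (kernelMoment φ u r - Complex.I * Real.log r * kernelMoment (deriv φ) u r) *
      ((deriv χ r : ℝ) : ℂ) +
    Real.log r / r * kernelMoment (deriv (deriv φ)) u r * (χ r : ℂ)

lemma hasDerivAt_radialDensity {φ χ : ℝ → ℝ} (hφ : ContDiff ℝ 2 φ)
    (hper : Function.Periodic φ (2 * Real.pi)) (hχ : Differentiable ℝ χ) {u : ℂ} (hu : ‖u‖ = 1)
    {r : ℝ} (hr : 0 < r) (hr1 : r ≠ 1) :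
    HasDerivAt (fun r => (kernelMoment φ u r -
        Complex.I * Real.log r * kernelMoment (deriv φ) u r) * (χ r : ℂ))
      (radialDensity φ χ u r) r := by
  have hφ' : ContDiff ℝ 1 (deriv φ) := hφ.deriv'
  have h1 := hasDerivAt_kernelMoment (hφ.of_le one_le_two) hper hu hr hr1
  have h2 := hasDerivAt_kernelMoment hφ' (periodic_deriv hper) hu hr hr1
  have h3 := ((Real.hasDerivAt_log hr.ne').ofReal_comp).const_mul Complex.I
  refine ((h1.sub (h3.mul h2)).mul (hχ r).hasDerivAt.ofReal_comp).congr_deriv ?_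
  have hrc : (r : ℂ) ≠ 0 := by exact_mod_cast hr.ne'
  simp only [radialDensity, Complex.ofReal_inv, Pi.sub_apply, Pi.mul_apply]
  linear_combination (-(Real.log r : ℂ) / r * kernelMoment (deriv (deriv φ)) u r * (χ r : ℂ)) *
    Complex.I_sq

lemma integral_radialDensity {φ χ : ℝ → ℝ} (hφ : ContDiff ℝ 2 φ)
    (hper : Function.Periodic φ (2 * Real.pi)) (hχ : Differentiable ℝ χ)
    (hχsupp : ∀ r, r ∉ Icc (1 / 2 : ℝ) 2 → χ r = 0) (hχone : χ 1 = 1) (α : ℝ)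
    (hdens : IntegrableOn (radialDensity φ χ (Complex.exp (α * Complex.I))) (Ioi 0)) :
    ∫ r in Ioi 0, radialDensity φ χ (Complex.exp (α * Complex.I)) r = 4 * Real.pi * φ α := by
  have hφ' : ContDiff ℝ 1 (deriv φ) := hφ.deriv'
  have hu := Complex.norm_exp_ofReal_mul_I α
  obtain ⟨L, hLl, hLr⟩ := exists_tendsto_kernelMoment (hφ.of_le one_le_two) hper α
  obtain ⟨L', hLl', hLr'⟩ := exists_tendsto_kernelMoment hφ' (periodic_deriv hper) α
  set u := Complex.exp (α * Complex.I)
  have hzero : ∀ r, r ∉ Icc (1 / 2 : ℝ) 2 → radialDensity φ χ u r = 0 := by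
    intro r hr
    have hev : χ =ᶠ[𝓝 r] fun _ => 0 := by
      filter_upwards [isClosed_Icc.isOpen_compl.mem_nhds hr] with x hx using hχsupp x hx
    simp [radialDensity, hev.deriv_eq, hχsupp r hr]
  have hlog : Tendsto (fun r : ℝ => Complex.I * (Real.log r : ℂ)) (𝓝 1) (𝓝 0) := by
    have h := ((Complex.continuous_ofReal.continuousAt.comp
      (Real.continuousAt_log one_ne_zero)).tendsto).const_mul Complex.I
    simpa using h
  have hχ1 : Tendsto (fun r => (χ r : ℂ)) (𝓝 1) (𝓝 1) := by
    have h := (Complex.continuous_ofReal.comp hχ.continuous).tendsto 1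
    simpa [hχone, Function.comp_def] using h
  have key : ∀ (l : Filter ℝ) (a b : ℂ), l ≤ 𝓝 1 → Tendsto (kernelMoment φ u) l (𝓝 a) →
      Tendsto (kernelMoment (deriv φ) u) l (𝓝 b) →
      Tendsto (fun r => (kernelMoment φ u r -
        Complex.I * Real.log r * kernelMoment (deriv φ) u r) * (χ r : ℂ)) l (𝓝 a) := by
    intro l a b hl ha hb
    simpa using (ha.sub ((hlog.mono_left hl).mul hb)).mul (hχ1.mono_left hl)
  have key0 : ∀ r, r ∉ Icc (1 / 2 : ℝ) 2 → Tendsto (fun r => (kernelMoment φ u r -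
        Complex.I * Real.log r * kernelMoment (deriv φ) u r) * (χ r : ℂ)) (𝓝 r) (𝓝 0) := by
    intro r hr
    refine tendsto_const_nhds.congr' ?_
    filter_upwards [isClosed_Icc.isOpen_compl.mem_nhds hr] with x hx
    simp [hχsupp x hx]
  have hi : ∀ a b : ℝ, 0 < a → a ≤ b → IntervalIntegrable (radialDensity φ χ u) volume a b := by
    intro a b ha hab
    rw [intervalIntegrable_iff_integrableOn_Ioc_of_le hab]
    exact hdens.mono_set fun x hx => ha.trans hx.1
  have hI1 : ∫ r in (1 / 4 : ℝ)..1, radialDensity φ χ u r = _ :=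
    intervalIntegral.integral_eq_sub_of_hasDerivAt_of_tendsto (by norm_num)
      (fun x hx => hasDerivAt_radialDensity hφ hper hχ hu (by linarith [hx.1]) hx.2.ne)
      (hi _ _ (by norm_num) (by norm_num))
      ((key0 (1 / 4) (by norm_num)).mono_left nhdsWithin_le_nhds)
      (key _ _ _ nhdsWithin_le_nhds hLl hLl')
  have hI2 : ∫ r in (1 : ℝ)..4, radialDensity φ χ u r = _ :=
    intervalIntegral.integral_eq_sub_of_hasDerivAt_of_tendsto (by norm_num)
      (fun x hx => hasDerivAt_radialDensity hφ hper hχ hu (by linarith [hx.1]) hx.1.ne')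
      (hi _ _ (by norm_num) (by norm_num))
      (key _ _ _ nhdsWithin_le_nhds hLr hLr')
      ((key0 4 (by norm_num)).mono_left nhdsWithin_le_nhds)
  have hsub : ∫ r in Ioi 0, radialDensity φ χ u r = ∫ r in (1 / 4 : ℝ)..4,
      radialDensity φ χ u r := by
    rw [intervalIntegral.integral_of_le (by norm_num)]
    refine setIntegral_eq_of_subset_of_forall_sdiff_eq_zero measurableSet_Ioi
      (fun x hx => lt_trans (by norm_num) hx.1) fun x hx => hzero x fun hx' => hx.2 ?_
    exact ⟨by linarith [hx'.1], by linarith [hx'.2]⟩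
  rw [hsub, ← intervalIntegral.integral_add_adjacent_intervals
    (hi (1 / 4) 1 (by norm_num) (by norm_num)) (hi 1 4 (by norm_num) (by norm_num)), hI1, hI2]
  ring

lemma integral_polar_of_point {φ χ : ℝ → ℝ} (hφ : ContDiff ℝ 2 φ)
    (hper : Function.Periodic φ (2 * Real.pi)) (hχ : Differentiable ℝ χ)
    (hχsupp : ∀ r, r ∉ Icc (1 / 2 : ℝ) 2 → χ r = 0) (hχone : χ 1 = 1) (α : ℝ)
    (hfst : IntegrableOn (fun p : ℝ × ℝ =>
      ((φ p.1 : ℂ) - Complex.I * (Real.log p.2 : ℂ) * ((deriv φ p.1 : ℝ) : ℂ)) *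
        ((deriv χ p.2 : ℝ) : ℂ) *
        cauchyKernel (Complex.exp (α * Complex.I)) (polarPoint p.2 p.1))
      (Ioc 0 (2 * Real.pi) ×ˢ Ioi (0 : ℝ)))
    (hsnd : IntegrableOn (fun p : ℝ × ℝ =>
      ((deriv (deriv φ) p.1 : ℝ) : ℂ) * (Real.log p.2 : ℂ) * ((χ p.2 : ℝ) : ℂ) / p.2 *
        cauchyKernel (Complex.exp (α * Complex.I)) (polarPoint p.2 p.1))
      (Ioc 0 (2 * Real.pi) ×ˢ Ioi (0 : ℝ))) :
    (∫ p in Ioc 0 (2 * Real.pi) ×ˢ Ioi (0 : ℝ),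
      ((φ p.1 : ℂ) - Complex.I * (Real.log p.2 : ℂ) * ((deriv φ p.1 : ℝ) : ℂ)) *
        ((deriv χ p.2 : ℝ) : ℂ) *
        cauchyKernel (Complex.exp (α * Complex.I)) (polarPoint p.2 p.1)) +
    (∫ p in Ioc 0 (2 * Real.pi) ×ˢ Ioi (0 : ℝ),
      ((deriv (deriv φ) p.1 : ℝ) : ℂ) * (Real.log p.2 : ℂ) * ((χ p.2 : ℝ) : ℂ) / p.2 *
        cauchyKernel (Complex.exp (α * Complex.I)) (polarPoint p.2 p.1)) =
      4 * Real.pi * φ α := by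
  have hu := Complex.norm_exp_ofReal_mul_I α
  set u := Complex.exp (α * Complex.I) with hu_def
  have hφ' : ContDiff ℝ 1 (deriv φ) := hφ.deriv'
  have hc0 : Continuous fun θ => (φ θ : ℂ) := Complex.continuous_ofReal.comp hφ.continuous
  have hc1 : Continuous fun θ => ((deriv φ θ : ℝ) : ℂ) :=
    Complex.continuous_ofReal.comp hφ'.continuous
  have hc2 : Continuous fun θ => ((deriv (deriv φ) θ : ℝ) : ℂ) :=
    Complex.continuous_ofReal.comp (hφ'.continuous_deriv le_rfl)
  have hsum := hfst.add hsnd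
  rw [← integral_add hfst hsnd]
  rw [IntegrableOn, Measure.volume_eq_prod, ← Measure.prod_restrict] at hsum
  rw [Measure.volume_eq_prod, ← Measure.prod_restrict]
  have hinner : ∀ᵐ r ∂(volume.restrict (Ioi (0 : ℝ))), (∫ θ in Ioc 0 (2 * Real.pi),
      (((φ θ : ℂ) - Complex.I * (Real.log r : ℂ) * ((deriv φ θ : ℝ) : ℂ)) *
        ((deriv χ r : ℝ) : ℂ) * cauchyKernel u (polarPoint r θ) +
      ((deriv (deriv φ) θ : ℝ) : ℂ) * (Real.log r : ℂ) * ((χ r : ℝ) : ℂ) / r *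
        cauchyKernel u (polarPoint r θ))) = radialDensity φ χ u r := by
    filter_upwards [ae_restrict_mem measurableSet_Ioi,
      ae_restrict_of_ae (Measure.ae_ne volume (1 : ℝ))] with r hr hr1
    have hk := continuous_cauchyKernel_polarPoint hu (le_of_lt hr) hr1
    rw [← intervalIntegral.integral_of_le (by positivity), radialDensity]
    simp only [kernelMoment, ← intervalIntegral.integral_const_mul,
      ← intervalIntegral.integral_mul_const]
    rw [← intervalIntegral.integral_sub, ← intervalIntegral.integral_mul_const,
      ← intervalIntegral.integral_add]
    · exact intervalIntegral.integral_congr fun θ _ => by ring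
    all_goals exact Continuous.intervalIntegrable (by fun_prop) _ _
  refine (integral_prod_symm _ hsum).trans ?_
  refine (integral_congr_ae hinner).trans ?_
  exact integral_radialDensity hφ hper hχ hχsupp hχone α (hsum.integral_prod_right.congr hinner)

lemma integrable_mul_cauchyKernel (μ : Measure Circle) [IsFiniteMeasure μ] {E : ℝ × ℝ → ℂ}
    (hE : Measurable E) {C : ℝ}
    (hEb : ∀ p : ℝ × ℝ, p.2 ∈ Icc (1 / 2 : ℝ) 2 → ‖E p‖ ≤ C * |1 - p.2|)
    (hE0 : ∀ p : ℝ × ℝ, p.2 ∉ Icc (1 / 2 : ℝ) 2 → E p = 0) :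
    Integrable (fun q : (ℝ × ℝ) × Circle => E q.1 * cauchyKernel q.2 (polarPoint q.1.2 q.1.1))
      ((volume.restrict (Ioc 0 (2 * Real.pi) ×ˢ Ioi (0 : ℝ))).prod μ) := by
  have hC : 0 ≤ C := by
    have h := (norm_nonneg _).trans (hEb (0, 2) (by norm_num))
    norm_num at h
    exact h
  have hT : MeasurableSet {p : ℝ × ℝ | p.2 ∈ Icc (1 / 2 : ℝ) 2} :=
    measurable_snd measurableSet_Icc
  have hg : Integrable ({p : ℝ × ℝ | p.2 ∈ Icc (1 / 2 : ℝ) 2}.indicator fun _ => 3 * C)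
      (volume.restrict (Ioc 0 (2 * Real.pi) ×ˢ Ioi (0 : ℝ))) := by
    rw [integrable_indicator_iff hT]
    refine integrableOn_const ?_
    rw [Measure.restrict_apply hT]
    refine ((measure_mono (t := Icc 0 (2 * Real.pi) ×ˢ Icc (1 / 2 : ℝ) 2) ?_).trans_lt
      (isCompact_Icc.prod isCompact_Icc).measure_lt_top).ne
    exact fun p hp => ⟨Ioc_subset_Icc_self hp.2.1, hp.1⟩
  have hcoe : Measurable fun q : (ℝ × ℝ) × Circle => (q.2 : ℂ) :=
    (show Continuous fun u : Circle => (u : ℂ) by fun_prop).measurable.comp measurable_snd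
  have hP : Measurable fun q : (ℝ × ℝ) × Circle => polarPoint q.1.2 q.1.1 :=
    continuous_polarPoint.measurable.comp (f := fun q : (ℝ × ℝ) × Circle => (q.1.2, q.1.1))
      (by fun_prop)
  refine (hg.comp_fst μ).mono' ((hE.comp measurable_fst).mul
    ((hcoe.add hP).div (hcoe.sub hP))).aestronglyMeasurable (ae_of_all _ fun q => ?_)
  by_cases h : q.1.2 ∈ Icc (1 / 2 : ℝ) 2
  · rw [indicator_of_mem (by exact h), norm_mul]
    have h1 := abs_one_sub_mul_norm_cauchyKernel_le (Circle.norm_coe q.2)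
      (by linarith [h.1] : 0 ≤ q.1.2) q.1.1
    calc _ ≤ C * |1 - q.1.2| * ‖cauchyKernel q.2 (polarPoint q.1.2 q.1.1)‖ := by
          gcongr; exact hEb _ h
      _ = C * (|1 - q.1.2| * ‖cauchyKernel q.2 (polarPoint q.1.2 q.1.1)‖) := by ring
      _ ≤ C * 3 := by gcongr; linarith [h.2]
      _ = 3 * C := by ring
  · rw [indicator_of_notMem (by exact h), hE0 _ h, zero_mul, norm_zero]

lemma abs_log_le_two_mul {r : ℝ} (hr : 1 / 2 ≤ r) : |Real.log r| ≤ 2 * |1 - r| := by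
  have hr0 : 0 < r := by linarith
  have h1 := Real.log_le_sub_one_of_pos hr0
  have h2 := Real.one_sub_inv_le_log_of_pos hr0
  have h3 : r⁻¹ ≤ 2 := by
    rw [inv_le_comm₀ hr0 two_pos]; linarith
  have h4 : 1 - r⁻¹ = -(r⁻¹ * (1 - r)) := by field_simp; ring
  have h5 : |r⁻¹ * (1 - r)| ≤ 2 * |1 - r| := by
    rw [abs_mul, abs_of_pos (inv_pos.2 hr0)]; gcongr
  rw [abs_le]
  constructor
  · linarith [le_abs_self (r⁻¹ * (1 - r))]
  · linarith [neg_abs_le (1 - r), abs_nonneg (1 - r)]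

lemma exists_bound_of_periodic {ψ : ℝ → ℝ} (hψ : Continuous ψ)
    (hper : Function.Periodic ψ (2 * Real.pi)) : ∃ M, ∀ x, |ψ x| ≤ M := by
  obtain ⟨M, hM⟩ := isBounded_iff_forall_norm_le.1
    (hper.isBounded_of_continuous Real.two_pi_pos.ne' hψ)
  exact ⟨M, fun x => hM _ (mem_range_self x)⟩

lemma exists_bound_first_term {φ χ : ℝ → ℝ} (hφ : ContDiff ℝ 2 φ)
    (hper : Function.Periodic φ (2 * Real.pi)) (hχ : ContDiff ℝ 1 χ)
    (hχone : ∀ r ∈ Icc (3 / 4 : ℝ) (4 / 3), χ r = 1) :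
    ∃ C, ∀ p : ℝ × ℝ, p.2 ∈ Icc (1 / 2 : ℝ) 2 →
      ‖((φ p.1 : ℂ) - Complex.I * (Real.log p.2 : ℂ) * ((deriv φ p.1 : ℝ) : ℂ)) *
        ((deriv χ p.2 : ℝ) : ℂ)‖ ≤ C * |1 - p.2| := by
  obtain ⟨M, hM⟩ := exists_bound_of_periodic hφ.continuous hper
  obtain ⟨M', hM'⟩ := exists_bound_of_periodic (hφ.continuous_deriv one_le_two)
    (periodic_deriv hper)
  obtain ⟨B, hB⟩ := (isCompact_Icc (a := (1 / 2 : ℝ)) (b := 2)).exists_bound_of_continuousOn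
    (hχ.continuous_deriv le_rfl).continuousOn
  have hM0 := (abs_nonneg _).trans (hM 0)
  have hM0' := (abs_nonneg _).trans (hM' 0)
  have hB0 := (norm_nonneg _).trans (hB 1 (by norm_num))
  refine ⟨4 * ((M + 2 * M') * B), fun p hp => ?_⟩
  rcases lt_or_ge |1 - p.2| (1 / 4) with h | h
  · have hev : χ =ᶠ[𝓝 p.2] fun _ => 1 := by
      rw [abs_lt] at h
      filter_upwards [Icc_mem_nhds (by linarith : 3 / 4 < p.2) (by linarith : p.2 < 4 / 3)]
        with x hx using hχone x hx
    rw [hev.deriv_eq]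
    simp only [deriv_const, Complex.ofReal_zero, mul_zero, norm_zero]
    positivity
  · have hlog : |Real.log p.2| ≤ 2 := by
      have h1 := abs_log_le_two_mul hp.1
      have h2 : |1 - p.2| ≤ 1 := abs_le.2 ⟨by linarith [hp.2], by linarith [hp.1]⟩
      linarith
    have h1 : ‖(φ p.1 : ℂ) - Complex.I * (Real.log p.2 : ℂ) * ((deriv φ p.1 : ℝ) : ℂ)‖ ≤
        M + 2 * M' := by
      refine (norm_sub_le _ _).trans ?_
      rw [norm_mul, norm_mul, Complex.norm_I, one_mul, Complex.norm_real, Complex.norm_real,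
        Complex.norm_real, Real.norm_eq_abs, Real.norm_eq_abs, Real.norm_eq_abs]
      gcongr
      exacts [hM _, hM' _]
    rw [norm_mul, Complex.norm_real]
    calc _ ≤ (M + 2 * M') * B := by gcongr; exact hB _ hp
      _ = 4 * ((M + 2 * M') * B) * (1 / 4) := by ring
      _ ≤ _ := by gcongr

lemma exists_bound_second_term {φ χ : ℝ → ℝ} (hφ : ContDiff ℝ 2 φ)
    (hper : Function.Periodic φ (2 * Real.pi)) (hχ : Continuous χ) :
    ∃ C, ∀ p : ℝ × ℝ, p.2 ∈ Icc (1 / 2 : ℝ) 2 →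
      ‖((deriv (deriv φ) p.1 : ℝ) : ℂ) * (Real.log p.2 : ℂ) * ((χ p.2 : ℝ) : ℂ) / p.2‖ ≤
        C * |1 - p.2| := by
  have hφ' : ContDiff ℝ 1 (deriv φ) := hφ.deriv'
  obtain ⟨M, hM⟩ := exists_bound_of_periodic (hφ'.continuous_deriv le_rfl)
    (periodic_deriv (periodic_deriv hper))
  obtain ⟨B, hB⟩ := (isCompact_Icc (a := (1 / 2 : ℝ)) (b := 2)).exists_bound_of_continuousOn
    hχ.continuousOn
  have hM0 := (abs_nonneg _).trans (hM 0)
  have hB0 := (norm_nonneg _).trans (hB 1 (by norm_num))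
  refine ⟨M * 2 * B * 2, fun p hp => ?_⟩
  have hp0 : 0 < p.2 := by linarith [hp.1]
  have hinv : p.2⁻¹ ≤ 2 := by
    rw [inv_le_comm₀ hp0 two_pos]; linarith [hp.1]
  rw [div_eq_mul_inv, norm_mul, norm_mul, norm_mul, norm_inv, Complex.norm_real,
    Complex.norm_real, Complex.norm_real, Complex.norm_real, Real.norm_of_nonneg hp0.le]
  calc _ ≤ M * (2 * |1 - p.2|) * B * 2 := by
        gcongr
        exacts [hM _, abs_log_le_two_mul hp.1, hB _ hp]
    _ = _ := by ring

/-- (Helffer–Sjöstrand formula on the unit circle.) For a probability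
measure `μ` on the unit circle, a `C²` and `2π`-periodic `φ : ℝ → ℝ`, and a smooth cutoff
`χ` supported in `[1/2, 2]` with `χ ≡ 1` on `[3/4, 4/3]`:
`∫ φ dμ = (1/4π)·∬ (φ(θ) − i·log r·φ'(θ))·χ'(r)·f_μ(r e^{iθ}) dr dθ
        + (1/4π)·∬ φ''(θ)·log r·χ(r)·f_μ(r e^{iθ})·r⁻¹ dr dθ`,
both double integrals (over `θ ∈ (0, 2π]`, `r ∈ (0, ∞)`) converging absolutely. -/
theorem stmt_13 (μ : Measure Circle) [IsProbabilityMeasure μ] (φ χ : ℝ → ℝ)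
    (hφ : ContDiff ℝ 2 φ) (hper : Function.Periodic φ (2 * Real.pi))
    (hχ : ContDiff ℝ (⊤ : ℕ∞) χ) (hχsupp : ∀ r, r ∉ Set.Icc (1 / 2 : ℝ) 2 → χ r = 0)
    (hχone : ∀ r ∈ Set.Icc (3 / 4 : ℝ) (4 / 3), χ r = 1) :
    IntegrableOn
        (fun p : ℝ × ℝ =>
          (((φ p.1 : ℝ) : ℂ) - Complex.I * (Real.log p.2 : ℂ) * ((deriv φ p.1 : ℝ) : ℂ)) *
            ((deriv χ p.2 : ℝ) : ℂ) *
            cauchyTransform μ ((p.2 : ℂ) * Complex.exp ((p.1 : ℂ) * Complex.I)))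
        (Set.Ioc 0 (2 * Real.pi) ×ˢ Set.Ioi (0 : ℝ)) ∧
      IntegrableOn
        (fun p : ℝ × ℝ =>
          ((deriv (deriv φ) p.1 : ℝ) : ℂ) * (Real.log p.2 : ℂ) * ((χ p.2 : ℝ) : ℂ) *
            cauchyTransform μ ((p.2 : ℂ) * Complex.exp ((p.1 : ℂ) * Complex.I)) / (p.2 : ℂ))
        (Set.Ioc 0 (2 * Real.pi) ×ˢ Set.Ioi (0 : ℝ)) ∧
      ((∫ u : Circle, φ (Complex.arg (u : ℂ)) ∂μ : ℝ) : ℂ) =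
        (1 / (4 * (Real.pi : ℂ))) *
            (∫ p in Set.Ioc 0 (2 * Real.pi) ×ˢ Set.Ioi (0 : ℝ),
              (((φ p.1 : ℝ) : ℂ) - Complex.I * (Real.log p.2 : ℂ) * ((deriv φ p.1 : ℝ) : ℂ)) *
                ((deriv χ p.2 : ℝ) : ℂ) *
                cauchyTransform μ ((p.2 : ℂ) * Complex.exp ((p.1 : ℂ) * Complex.I))) +
          (1 / (4 * (Real.pi : ℂ))) *
            (∫ p in Set.Ioc 0 (2 * Real.pi) ×ˢ Set.Ioi (0 : ℝ),
              ((deriv (deriv φ) p.1 : ℝ) : ℂ) * (Real.log p.2 : ℂ) * ((χ p.2 : ℝ) : ℂ) *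
                cauchyTransform μ ((p.2 : ℂ) * Complex.exp ((p.1 : ℂ) * Complex.I)) /
                  (p.2 : ℂ)) := by
  set S := Ioc 0 (2 * Real.pi) ×ˢ Ioi (0 : ℝ)
  have hχ1 : ContDiff ℝ 1 χ := hχ.of_le (by exact_mod_cast le_top)
  have hχd : Differentiable ℝ χ := hχ1.differentiable one_ne_zero
  have hφ' : ContDiff ℝ 1 (deriv φ) := hφ.deriv'
  obtain ⟨C₁, hC₁⟩ := exists_bound_first_term hφ hper hχ1 hχone
  obtain ⟨C₂, hC₂⟩ := exists_bound_second_term hφ hper hχ1.continuous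
  have hm0 : Measurable φ := hφ.continuous.measurable
  have hm1 : Measurable (deriv φ) := hφ'.continuous.measurable
  have hm2 : Measurable (deriv (deriv φ)) := (hφ'.continuous_deriv le_rfl).measurable
  have hmχ : Measurable χ := hχ1.continuous.measurable
  have hmχ' : Measurable (deriv χ) := (hχ1.continuous_deriv le_rfl).measurable
  have hdens₁ := integrable_mul_cauchyKernel μ (by fun_prop) hC₁ fun p hp => by
    have hev : χ =ᶠ[𝓝 p.2] fun _ => 0 := by
      filter_upwards [isClosed_Icc.isOpen_compl.mem_nhds hp] with x hx using hχsupp x hx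
    simp [hev.deriv_eq]
  have hdens₂ := integrable_mul_cauchyKernel μ (by fun_prop) hC₂ fun p hp => by
    simp [hχsupp _ hp]
  have heq₁ : (fun p : ℝ × ℝ =>
      (((φ p.1 : ℝ) : ℂ) - Complex.I * (Real.log p.2 : ℂ) * ((deriv φ p.1 : ℝ) : ℂ)) *
        ((deriv χ p.2 : ℝ) : ℂ) *
        cauchyTransform μ ((p.2 : ℂ) * Complex.exp ((p.1 : ℂ) * Complex.I))) = fun p =>
      ∫ u : Circle,
        (((φ p.1 : ℝ) : ℂ) - Complex.I * (Real.log p.2 : ℂ) * ((deriv φ p.1 : ℝ) : ℂ)) *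
          ((deriv χ p.2 : ℝ) : ℂ) * cauchyKernel u (polarPoint p.2 p.1) ∂μ := by
    funext p
    rw [integral_const_mul]
    rfl
  have heq₂ : (fun p : ℝ × ℝ =>
      ((deriv (deriv φ) p.1 : ℝ) : ℂ) * (Real.log p.2 : ℂ) * ((χ p.2 : ℝ) : ℂ) *
        cauchyTransform μ ((p.2 : ℂ) * Complex.exp ((p.1 : ℂ) * Complex.I)) / (p.2 : ℂ)) =
      fun p => ∫ u : Circle,
        ((deriv (deriv φ) p.1 : ℝ) : ℂ) * (Real.log p.2 : ℂ) * ((χ p.2 : ℝ) : ℂ) / p.2 *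
          cauchyKernel u (polarPoint p.2 p.1) ∂μ := by
    funext p
    rw [integral_const_mul, mul_div_right_comm]
    rfl
  rw [heq₁, heq₂]
  refine ⟨hdens₁.integral_prod_left, hdens₂.integral_prod_left, ?_⟩
  have hswap : ∀ {f : (ℝ × ℝ) × Circle → ℂ}, Integrable f ((volume.restrict S).prod μ) →
      ∫ p in S, ∫ u, f (p, u) ∂μ = ∫ u, (∫ p in S, f (p, u)) ∂μ :=
    fun {f} hf => integral_integral_swap (f := fun p u => f (p, u)) hf
  have hswap₁ := hswap hdens₁
  have hswap₂ := hswap hdens₂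
  dsimp only at hswap₁ hswap₂
  rw [hswap₁, hswap₂, ← mul_add, ← integral_add hdens₁.integral_prod_right hdens₂.integral_prod_right]
  rw [integral_congr_ae
    (g := fun u : Circle => (4 * Real.pi : ℂ) * (φ (Complex.arg u) : ℂ)) ?_,
    integral_const_mul, integral_complex_ofReal]
  · have hpi : (Real.pi : ℂ) ≠ 0 := by exact_mod_cast Real.pi_ne_zero
    field_simp
  · filter_upwards [hdens₁.prod_left_ae, hdens₂.prod_left_ae] with u h₁ h₂
    have hu : Complex.exp (Complex.arg u * Complex.I) = u := by
      have h := Complex.norm_mul_exp_arg_mul_I (u : ℂ)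
      rwa [Circle.norm_coe, Complex.ofReal_one, one_mul] at h
    have h := integral_polar_of_point hφ hper hχd hχsupp (hχone 1 (by norm_num))
      (Complex.arg u) (by rwa [hu]) (by rwa [hu])
    rwa [hu] at h

end
end
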